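/- arXiv:1909.00940 — 3 statements merged into one kernel-verified Lean document; each statement's English description precedes it below -/
import Mathlib

section
/- Brouwer's fixed-point theorem: Let δ ⊆ ℝ^d be a geometric n-simplex. Then every continuous map f: δ → δ has a fixed point. -/
/-- A set `σ` is dominant for the rankings `r i` if no point is ranked strictly above the
`i`-th minimum of `σ` for every `i`. -/
def ScarfDominant {I X : Type*} (r : I → X → ℕ) (σ : Finset X) : Prop :=
  ∀ y, ∃ i, ∀ x ∈ σ, r i y ≤ r i x

namespace ScarfDominant

open Finset

variable {I X : Type*} {r : I → X → ℕ}

lemma mono {σ τ : Finset X} (h : ScarfDominant r σ) (hτ : τ ⊆ σ) : ScarfDominant r τ :=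
  fun y => (h y).imp fun _ hi x hx => hi x (hτ hx)

/-- A family of `#τ + 1` points covering `τ` without using the index `l` is injective away
from `l`. -/
lemma injOn_of_cover [Fintype I] [DecidableEq I] [DecidableEq X] {τ : Finset X}
    (hτ : #τ + 1 = Fintype.card I) {m : I → X} {l : I}
    (h : ∀ x ∈ τ, ∃ k, k ≠ l ∧ m k = x) : Set.InjOn m (univ.erase l : Finset I) := by
  rw [← card_image_iff]
  apply le_antisymm card_image_le
  rw [card_erase_of_mem (mem_univ l), card_univ, ← hτ, Nat.add_sub_cancel]
  apply card_le_card
  intro x hx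
  obtain ⟨k, hk, rfl⟩ := h x hx
  exact mem_image_of_mem _ (by simp [hk])

/-- Points ranked above the minima `m k` of a set for every `k ≠ l`. -/
def above (r : I → X → ℕ) (m : I → X) (l : I) : Set X := {y | ∀ k, k ≠ l → r k (m k) < r k y}

/-- The minima of a dominant set `τ` with one element less than there are rankings coincide for
exactly one pair of rankings, and the dominant extensions of `τ` by a point correspond to this
pair. -/
lemma exists_pair [Fintype I] [DecidableEq I] [DecidableEq X]
    {τ : Finset X} (hr : ∀ i, Function.Injective (r i))
    (hτ : #τ + 1 = Fintype.card I) (hd : ScarfDominant r τ) {m : I → X} (hm : ∀ i, m i ∈ τ)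
    (hmin : ∀ i, ∀ x ∈ τ, r i (m i) ≤ r i x) :
    ∃ i j, i ≠ j ∧ m i = m j ∧
      Set.InjOn m (univ.erase i : Finset I) ∧ Set.InjOn m (univ.erase j : Finset I) ∧
      (∀ y, y ∉ above r m i ∨ y ∉ above r m j) ∧
      ∀ y, (y ∉ τ ∧ ScarfDominant r (insert y τ)) ↔
        ∃ l, (l = i ∨ l = j) ∧ y ∈ above r m l ∧ ∀ z ∈ above r m l, r l z ≤ r l y := by
  have hsurj : ∀ x ∈ τ, ∃ k, m k = x := fun x hx => by
    obtain ⟨k, hk⟩ := hd x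
    exact ⟨k, hr k (le_antisymm (hmin k x hx) (hk _ (hm k)))⟩
  obtain ⟨i, -, j, -, hij, he⟩ := exists_ne_map_eq_of_card_lt_of_maps_to
    (s := (univ : Finset I)) (t := τ) (f := m) (by rw [card_univ]; omega) (fun i _ => hm i)
  have hci : ∀ x ∈ τ, ∃ k, k ≠ i ∧ m k = x := fun x hx => by
    obtain ⟨k, hk⟩ := hsurj x hx
    by_cases h : k = i
    · exact ⟨j, hij.symm, by rw [← he, ← h, hk]⟩
    · exact ⟨k, h, hk⟩
  have hcj : ∀ x ∈ τ, ∃ k, k ≠ j ∧ m k = x := fun x hx => by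
    obtain ⟨k, hk⟩ := hsurj x hx
    by_cases h : k = j
    · exact ⟨i, hij, by rw [he, ← h, hk]⟩
    · exact ⟨k, h, hk⟩
  refine ⟨i, j, hij, he, injOn_of_cover hτ hci, injOn_of_cover hτ hcj, ?_, ?_⟩
  · intro y
    by_contra! h
    obtain ⟨k, hk⟩ := hd y
    have hk := hk _ (hm k)
    by_cases hki : k = i
    · exact absurd (h.2 k (by rw [hki]; exact hij)) (by omega)
    · exact absurd (h.1 k hki) (by omega)
  · intro y
    constructor
    · rintro ⟨hy, hD⟩
      obtain ⟨l, hl⟩ := hD y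
      have hlt : ∀ x ∈ τ, r l y < r l x := fun x hx =>
        lt_of_le_of_ne (hl x (mem_insert_of_mem hx)) fun h => hy (hr l h ▸ hx)
      have hcl : ∀ x ∈ τ, ∃ k, k ≠ l ∧ m k = x ∧ r k x < r k y := fun x hx => by
        obtain ⟨k, hk⟩ := hD x
        have hky := hk y (mem_insert_self _ _)
        refine ⟨k, ?_, hr k (le_antisymm (hmin k x hx) (hk _ (mem_insert_of_mem (hm k)))),
          lt_of_le_of_ne hky fun h => hy (hr k h ▸ hx)⟩
        rintro rfl
        exact absurd (hlt x hx) (by omega)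
      have hinj := injOn_of_cover hτ fun x hx => by
        obtain ⟨k, h1, h2, -⟩ := hcl x hx
        exact ⟨k, h1, h2⟩
      refine ⟨l, ?_, ?_, ?_⟩
      · by_contra! h
        exact hij (hinj (by simpa using h.1.symm) (by simpa using h.2.symm) he)
      · intro k hk
        obtain ⟨k', h1, h2, h3⟩ := hcl (m k) (hm k)
        obtain rfl : k' = k := hinj (by simpa using h1) (by simpa using hk) h2
        exact h3
      · intro z hz
        obtain ⟨k, hk⟩ := hD z
        by_cases h : k = l
        · subst h
          exact hk y (mem_insert_self _ _)
        · exact absurd (hz k h) (not_lt.2 (hk _ (mem_insert_of_mem (hm k))))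
    · rintro ⟨l, hl, hy, hmax⟩
      have hcl : ∀ x ∈ τ, ∃ k, k ≠ l ∧ m k = x := by
        rcases hl with rfl | rfl <;> assumption
      refine ⟨fun h => ?_, fun z => ?_⟩
      · obtain ⟨k, hk, rfl⟩ := hcl y h
        exact lt_irrefl _ (hy k hk)
      · obtain ⟨k, hk⟩ := hd z
        by_cases hzy : r k z ≤ r k y
        · exact ⟨k, by simpa using ⟨hzy, hk⟩⟩
        · have hkl : k = l := by
            by_contra h
            have h1 := hy k h
            have h2 := hk _ (hm k)
            omega
          subst hkl
          have hz : z ∉ above r m k := fun h => hzy (hmax z h)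
          simp only [above, Set.mem_ofPred_eq, not_forall, not_lt] at hz
          obtain ⟨k', h1, h2⟩ := hz
          refine ⟨k', ?_⟩
          simp only [mem_insert, forall_eq_or_imp]
          exact ⟨h2.trans (hy k' h1).le, fun x hx => h2.trans (hmin k' x hx)⟩

lemma exists_max_above [Finite X] {m : I → X} {l : I} (h : (above r m l).Nonempty) :
    ∃ y ∈ above r m l, ∀ z ∈ above r m l, r l z ≤ r l y :=
  Set.exists_max_image _ (r l) (Set.toFinite _) h

lemma exists_min [Fintype I]
    (hI : 1 < Fintype.card I) {τ : Finset X} (hτ : #τ + 1 = Fintype.card I) :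
    ∃ m : I → X, (∀ i, m i ∈ τ) ∧ ∀ i, ∀ x ∈ τ, r i (m i) ≤ r i x := by
  have hne : τ.Nonempty := card_pos.1 (by omega)
  choose m hm hmin using fun i => exists_min_image τ (r i) hne
  exact ⟨m, hm, hmin⟩

lemma card_filter_subset [Fintype I] [DecidableEq X] [Fintype X]
    {τ : Finset X} (hτ : #τ + 1 = Fintype.card I)
    {R : Finset (Finset X)}
    (hR : ∀ σ, σ ∈ R ↔ ScarfDominant r σ ∧ #σ = Fintype.card I) {S : Finset X}
    (hS : ∀ y, (y ∉ τ ∧ ScarfDominant r (insert y τ)) ↔ y ∈ S) :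
    #{σ ∈ R | τ ⊆ σ} = #S := by
  have : ({σ ∈ R | τ ⊆ σ} : Finset _) = S.image (insert · τ) := by
    ext σ
    simp only [mem_filter, hR, mem_image]
    constructor
    · rintro ⟨⟨h1, h2⟩, h3⟩
      obtain ⟨y, hy, rfl⟩ := exists_eq_insert_iff.2 ⟨h3, by omega⟩
      exact ⟨y, (hS y).1 ⟨hy, h1⟩, rfl⟩
    · rintro ⟨y, hy, rfl⟩
      obtain ⟨h1, h2⟩ := (hS y).2 hy
      exact ⟨⟨h2, by rw [card_insert_of_notMem h1, hτ]⟩, subset_insert _ _⟩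
  rw [this, card_image_of_injOn]
  intro a ha b hb hab
  exact (insert_inj ((hS a).2 ha).1).1 hab

/-- A dominant set of size `#I - 1` has two dominant extensions when it contains a point that is
ranked below every slack point `s j`, `j ≠ i`, by every `r i`. -/
lemma card_filter_subset_eq_two [Fintype I] [DecidableEq I] [DecidableEq X] [Fintype X]
    (hI : 1 < Fintype.card I)
    (hr : ∀ i, Function.Injective (r i)) {s : I → X}
    {τ : Finset X} (hτ : #τ + 1 = Fintype.card I) (hd : ScarfDominant r τ)
    {R : Finset (Finset X)} (hR : ∀ σ, σ ∈ R ↔ ScarfDominant r σ ∧ #σ = Fintype.card I)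
    {t : X} (ht : t ∈ τ) (hlt : ∀ i j, j ≠ i → r i t < r i (s j)) :
    #{σ ∈ R | τ ⊆ σ} = 2 := by
  obtain ⟨m, hm, hmin⟩ := exists_min (r := r) hI hτ
  obtain ⟨i, j, hij, -, -, -, hdisj, hiff⟩ := exists_pair hr hτ hd hm hmin
  have hne : ∀ l, (above r m l).Nonempty := fun l =>
    ⟨s l, fun k hk => (hmin k t ht).trans_lt (hlt k l hk.symm)⟩
  obtain ⟨a, ha, ha'⟩ := exists_max_above (hne i)
  obtain ⟨b, hb, hb'⟩ := exists_max_above (hne j)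
  rw [card_filter_subset hτ hR (S := {a, b}), card_pair]
  · rintro rfl
    exact (hdisj a).elim (· ha) (· hb)
  · intro y
    rw [hiff, mem_insert, mem_singleton]
    constructor
    · rintro ⟨l, rfl | rfl, h1, h2⟩
      · exact .inl (hr l (le_antisymm (ha' _ h1) (h2 _ ha)))
      · exact .inr (hr l (le_antisymm (hb' _ h1) (h2 _ hb)))
    · rintro (rfl | rfl)
      · exact ⟨i, .inl rfl, ha, ha'⟩
      · exact ⟨j, .inr rfl, hb, hb'⟩

/-- The set of all slack points but one has a single dominant extension. -/
lemma card_filter_subset_eq_one [Fintype I] [DecidableEq I] [DecidableEq X] [Fintype X]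
    (hI : 1 < Fintype.card I)
    (hr : ∀ i, Function.Injective (r i)) {s : I → X} (hs : Function.Injective s)
    (hbot : ∀ i x, r i (s i) ≤ r i x)
    (hlt : ∀ x, x ∉ Set.range s → ∀ i j, j ≠ i → r i x < r i (s j))
    {t : X} (ht : t ∉ Set.range s)
    {R : Finset (Finset X)} (hR : ∀ σ, σ ∈ R ↔ ScarfDominant r σ ∧ #σ = Fintype.card I)
    {i₀ : I} {τ : Finset X} (hτ : τ = (univ.erase i₀).image s) (hd : ScarfDominant r τ) :
    #{σ ∈ R | τ ⊆ σ} = 1 := by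
  have hτc : #τ + 1 = Fintype.card I := by
    rw [hτ, card_image_of_injective _ hs, card_erase_of_mem (mem_univ _), card_univ]
    omega
  have hsτ : ∀ k, k ≠ i₀ → s k ∈ τ := fun k hk => hτ ▸ mem_image_of_mem _ (by simp [hk])
  obtain ⟨m, hm, hmin⟩ := exists_min (r := r) hI hτc
  have hms : ∀ k, k ≠ i₀ → m k = s k := fun k hk =>
    hr k (le_antisymm (hmin k _ (hsτ k hk)) (hbot _ _))
  obtain ⟨i, j, hij, he, -, -, -, hiff⟩ := exists_pair hr hτc hd hm hmin
  obtain ⟨j, hj, he, hiff⟩ : ∃ j, j ≠ i₀ ∧ m i₀ = m j ∧ ∀ y,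
      (y ∉ τ ∧ ScarfDominant r (insert y τ)) ↔
        ∃ l, (l = i₀ ∨ l = j) ∧ y ∈ above r m l ∧ ∀ z ∈ above r m l, r l z ≤ r l y := by
    by_cases hi : i = i₀
    · subst hi
      exact ⟨j, hij.symm, he, hiff⟩
    · by_cases hj : j = i₀
      · subst hj
        exact ⟨i, hij, he.symm, fun y => by rw [hiff]; simp only [or_comm]⟩
      · rw [hms i hi, hms j hj] at he
        exact absurd (hs he) hij
  have hne : (above r m i₀).Nonempty := ⟨t, fun k hk => by
    rw [hms k hk]
    exact lt_of_le_of_ne (hbot _ _) fun h => ht ⟨k, hr k h⟩⟩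
  have hempty : ∀ y, y ∉ above r m j := fun y hy => by
    have h0 := hy i₀ hj.symm
    rw [he, hms j hj] at h0
    by_cases hys : y ∈ Set.range s
    · obtain ⟨k, rfl⟩ := hys
      by_cases hk0 : k = i₀
      · subst hk0
        exact absurd (hbot k (s j)) (by omega)
      · by_cases hkj : k = j
        · subst hkj
          exact lt_irrefl _ h0
        · have := hy k hkj
          rw [hms k hk0] at this
          exact lt_irrefl _ this
    · exact absurd (hlt y hys i₀ j hj) (by omega)
  obtain ⟨a, ha, ha'⟩ := exists_max_above hne
  rw [card_filter_subset hτc hR (S := {a}), card_singleton]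
  intro y
  rw [hiff, mem_singleton]
  constructor
  · rintro ⟨l, rfl | rfl, h1, h2⟩
    · exact hr l (le_antisymm (ha' _ h1) (h2 _ ha))
    · exact absurd h1 (hempty y)
  · rintro rfl
    exact ⟨i₀, .inl rfl, ha, ha'⟩

/-- In a set of size `#I` that misses a color, the number of facets carrying exactly the colors
other than `i₀` is even. -/
lemma even_card_facets [Fintype I] [DecidableEq I] [DecidableEq X] [Fintype X]
    {c : X → I} {i₀ : I} {σ : Finset X} (hσ : #σ = Fintype.card I)
    (hc : σ.image c ≠ univ) {D : Finset (Finset X)}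
    (hD : ∀ τ, τ ⊆ σ → (τ ∈ D ↔ #τ + 1 = Fintype.card I ∧ τ.image c = univ.erase i₀)) :
    Even #{τ ∈ D | τ ⊆ σ} := by
  have himg : ({τ ∈ D | τ ⊆ σ} : Finset _) =
      ({x ∈ σ | (σ.erase x).image c = univ.erase i₀} : Finset X).image σ.erase := by
    ext τ
    simp only [mem_filter, mem_image]
    constructor
    · rintro ⟨h1, h2⟩
      obtain ⟨h3, h4⟩ := (hD τ h2).1 h1
      obtain ⟨x, hx, rfl⟩ := exists_eq_insert_iff.2 ⟨h2, by omega⟩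
      exact ⟨x, ⟨mem_insert_self _ _, by rwa [erase_insert hx]⟩, erase_insert hx⟩
    · rintro ⟨x, ⟨h1, h2⟩, rfl⟩
      exact ⟨(hD _ (erase_subset _ _)).2 ⟨by rw [card_erase_add_one h1, hσ], h2⟩,
        erase_subset _ _⟩
  rw [himg, card_image_of_injOn (σ.erase_injOn.mono fun x hx => (mem_filter.1 hx).1)]
  rcases ({x ∈ σ | (σ.erase x).image c = univ.erase i₀} : Finset X).eq_empty_or_nonempty with h | h
  · simp [h]
  obtain ⟨x, hx⟩ := h
  obtain ⟨hx, hxc⟩ := mem_filter.1 hx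
  have hcx : c x ≠ i₀ := fun h => hc (by
    rw [← insert_erase hx, image_insert, hxc, h, insert_erase (mem_univ _)])
  have hmem : c x ∈ (σ.erase x).image c := by rw [hxc]; simp [hcx]
  obtain ⟨x', hx', hcx'⟩ := mem_image.1 hmem
  have hinj : Set.InjOn c (σ.erase x) := by
    rw [← card_image_iff, hxc, card_erase_of_mem hx, card_erase_of_mem (mem_univ _), card_univ, hσ]
  have hxx' : x' ≠ x := (mem_erase.1 hx').1
  suffices ({x ∈ σ | (σ.erase x).image c = univ.erase i₀} : Finset X) = {x, x'} by
    rw [this, card_pair hxx'.symm]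
    exact even_two
  have hswap : (σ.erase x').image c = (σ.erase x).image c := by
    ext k
    simp only [mem_image, mem_erase]
    constructor
    · rintro ⟨z, ⟨h1, h2⟩, rfl⟩
      by_cases hz : z = x
      · exact ⟨x', ⟨hxx', (mem_erase.1 hx').2⟩, by rw [hz, hcx']⟩
      · exact ⟨z, ⟨hz, h2⟩, rfl⟩
    · rintro ⟨z, ⟨h1, h2⟩, rfl⟩
      by_cases hz : z = x'
      · exact ⟨x, ⟨hxx'.symm, hx⟩, by rw [hz, hcx']⟩
      · exact ⟨z, ⟨hz, h2⟩, rfl⟩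
  ext y
  simp only [mem_filter, mem_insert, mem_singleton]
  constructor
  · rintro ⟨h1, h2⟩
    by_contra! hy
    have hmem : c y ∈ (σ.erase y).image c := by
      rw [h2, ← hxc]
      exact mem_image_of_mem _ (mem_erase.2 ⟨hy.1, h1⟩)
    obtain ⟨z, hz, hzc⟩ := mem_image.1 hmem
    obtain ⟨hzy, hzσ⟩ := mem_erase.1 hz
    have hyx : y ∈ σ.erase x := mem_erase.2 ⟨hy.1, h1⟩
    by_cases hzx : z = x
    · subst hzx
      exact hy.2 (hinj hyx hx' (by rw [← hzc, hcx']))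
    · exact hzy (hinj (mem_erase.2 ⟨hzx, hzσ⟩) hyx hzc)
  · rintro (rfl | rfl)
    · exact ⟨hx, hxc⟩
    · exact ⟨(mem_erase.1 hx').2, hswap.trans hxc⟩

/-- **Scarf's lemma**: for every coloring of a finite set with one slack point per ranking,
where the `i`-th slack point has color `i`, there is a dominant set carrying all colors. -/
theorem exists_colorful [Fintype I] [Fintype X] (hI : 1 < Fintype.card I)
    (hr : ∀ i, Function.Injective (r i)) {s : I → X}
    (hbot : ∀ i x, r i (s i) ≤ r i x)
    (hlt : ∀ x, x ∉ Set.range s → ∀ i j, j ≠ i → r i x < r i (s j))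
    {t : X} (ht : t ∉ Set.range s) {c : X → I} (hc : ∀ i, c (s i) = i) :
    ∃ σ : Finset X, ScarfDominant r σ ∧ ∀ i, ∃ x ∈ σ, c x = i := by
  classical
  have hs : Function.Injective s := Function.LeftInverse.injective hc
  by_contra! hno
  obtain ⟨i₀⟩ : Nonempty I := Fintype.card_pos_iff.1 (by omega)
  obtain ⟨R, hR⟩ : ∃ R : Finset (Finset X),
      ∀ σ, σ ∈ R ↔ ScarfDominant r σ ∧ #σ = Fintype.card I :=
    ⟨({σ | ScarfDominant r σ ∧ #σ = Fintype.card I} : Finset _), by simp⟩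
  obtain ⟨D, hD⟩ : ∃ D : Finset (Finset X), ∀ τ, τ ∈ D ↔ ScarfDominant r τ ∧
      #τ + 1 = Fintype.card I ∧ τ.image c = univ.erase i₀ :=
    ⟨({τ | ScarfDominant r τ ∧ #τ + 1 = Fintype.card I ∧ τ.image c = univ.erase i₀} : Finset _),
      by simp⟩
  have heven : Even (∑ σ ∈ R, #{τ ∈ D | τ ⊆ σ}) := by
    refine even_sum _ fun σ hσ => ?_
    obtain ⟨h1, h2⟩ := (hR σ).1 hσ
    refine even_card_facets (i₀ := i₀) (c := c) h2 (fun h => ?_) fun τ hτ => ?_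
    · obtain ⟨i, hi⟩ := hno σ h1
      obtain ⟨x, hx, hxi⟩ := mem_image.1 (h ▸ mem_univ i)
      exact hi x hx hxi
    · simp [hD, h1.mono hτ]
  have hdouble : ∑ σ ∈ R, #{τ ∈ D | τ ⊆ σ} = ∑ τ ∈ D, #{σ ∈ R | τ ⊆ σ} := by
    simp only [card_filter]
    exact sum_comm
  set τ₀ : Finset X := (univ.erase i₀).image s with hτ₀
  have hdom₀ : ScarfDominant r τ₀ := fun y => by
    by_cases hy : ∃ k, k ≠ i₀ ∧ s k = y
    · obtain ⟨k, -, rfl⟩ := hy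
      exact ⟨k, fun x _ => hbot k x⟩
    · refine ⟨i₀, fun x hx => ?_⟩
      obtain ⟨k, hk, rfl⟩ := mem_image.1 hx
      by_cases hys : y ∈ Set.range s
      · obtain ⟨l, rfl⟩ := hys
        obtain rfl : l = i₀ := by
          by_contra h
          exact hy ⟨l, h, rfl⟩
        exact hbot _ _
      · exact (hlt y hys i₀ k (by simpa using hk)).le
  have hmem₀ : τ₀ ∈ D := by
    refine (hD _).2 ⟨hdom₀, ?_, ?_⟩
    · rw [hτ₀, card_image_of_injective _ hs, card_erase_of_mem (mem_univ _), card_univ]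
      omega
    · rw [hτ₀, image_image, show c ∘ s = id from funext hc, image_id]
  rw [hdouble, ← add_sum_erase _ _ hmem₀,
    card_filter_subset_eq_one hI hr hs hbot hlt ht hR hτ₀ hdom₀] at heven
  refine absurd heven (Nat.not_even_iff_odd.2 (odd_one.add_even (even_sum _ fun τ hτ => ?_)))
  obtain ⟨hne, hτD⟩ := mem_erase.1 hτ
  obtain ⟨hd, hcard, hcol⟩ := (hD _).1 hτD
  obtain ⟨x, hx, hxs⟩ : ∃ x ∈ τ, x ∉ Set.range s := by
    by_contra! hall
    refine hne (eq_of_subset_of_card_le (fun x hx => ?_) ?_)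
    · obtain ⟨k, rfl⟩ := hall x hx
      have : c (s k) ∈ univ.erase i₀ := hcol ▸ mem_image_of_mem c hx
      rw [hc] at this
      exact mem_image_of_mem s this
    · have : #τ₀ ≤ #(univ.erase i₀ : Finset I) := card_image_le
      rw [card_erase_of_mem (mem_univ _), card_univ] at this
      omega
  rw [card_filter_subset_eq_two hI hr hcard hd hR hx (hlt x hxs)]
  exact even_two

end ScarfDominant

namespace BrouwerFixedPoint

open Finset Filter Topology

variable {I : Type*} [Fintype I]

/-- The grid points `a : I → ℕ` with coordinate sum `N`. -/
abbrev Grid (I : Type*) [Fintype I] (N : ℕ) : Type _ := {a : I → Fin (N + 1) // ∑ i, (a i : ℕ) = N}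

lemma Grid.exists_coe_eq {N : ℕ} (a : I → ℕ) (ha : ∑ i, a i = N) :
    ∃ b : Grid I N, ∀ i, (b.1 i : ℕ) = a i :=
  ⟨⟨fun i => ⟨a i, Nat.lt_succ_of_le (ha ▸ single_le_sum (fun _ _ => Nat.zero_le _)
    (mem_univ i))⟩, ha⟩, fun _ => rfl⟩

lemma exists_le (p q : stdSimplex ℝ I) : ∃ i, p.1 i ≤ q.1 i := by
  have hne : (univ : Finset I).Nonempty := by
    rw [nonempty_iff_ne_empty]
    intro h
    have := p.2.2
    simp [h] at this
  obtain ⟨i, -, hi⟩ := exists_le_of_sum_le hne (p.2.2.trans q.2.2.symm).le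
  exact ⟨i, hi⟩

lemma convexHull_range_eq_image {E : Type*} [AddCommGroup E] [Module ℝ E] (v : I → E) :
    convexHull ℝ (Set.range v) = (fun w : I → ℝ => ∑ i, w i • v i) '' stdSimplex ℝ I := by
  classical
  have : (fun w : I → ℝ => ∑ i, w i • v i) = Fintype.linearCombination ℝ v := by
    ext w
    rw [Fintype.linearCombination_apply]
  rw [this, ← convexHull_rangle_single_eq_stdSimplex, LinearMap.image_convexHull,
    ← Set.range_comp]
  congr 2
  ext i
  simp

/-- The point of the standard simplex with barycentric coordinates `a i / N`. -/
noncomputable def Grid.toSimplex {N : ℕ} (hN : N ≠ 0) (a : Grid I N) : stdSimplex ℝ I :=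
  ⟨fun i => (a.1 i : ℕ) / N, fun i => by positivity, by
    rw [← sum_div, ← Nat.cast_sum, a.2, div_self (Nat.cast_ne_zero.2 hN)]⟩

variable [DecidableEq I]

/-- The ranking of grid points by their `i`-th coordinate, with ties broken by an enumeration, the
`i`-th slack point put at the bottom and the other slack points at the top. -/
noncomputable def rank {N : ℕ} (i : I) : Grid I N ⊕ I → ℕ
  | .inl a => 1 + (a.1 i * Fintype.card (Grid I N) + Fintype.equivFin (Grid I N) a)
  | .inr j => if j = i then 0 else
      1 + ((N + 1) * Fintype.card (Grid I N) + Fintype.equivFin I j)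

lemma rank_inr_self {N : ℕ} (i : I) : rank (N := N) i (.inr i) = 0 := by simp [rank]

lemma rank_inl_pos {N : ℕ} (i : I) (a : Grid I N) : 0 < rank i (.inl a) := by
  simp only [rank]
  omega

lemma rank_inl_lt {N : ℕ} {i : I} {a b : Grid I N} (h : a.1 i < b.1 i) :
    rank i (.inl a) < rank i (.inl b) := by
  simp only [rank]
  have h1 := (Fintype.equivFin (Grid I N) a).2
  have h2 : ((a.1 i : ℕ) + 1) * Fintype.card (Grid I N) ≤ b.1 i * Fintype.card (Grid I N) :=
    Nat.mul_le_mul_right _ h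
  rw [add_one_mul] at h2
  omega

lemma rank_inl_lt_inr {N : ℕ} {i j : I} (h : j ≠ i) (a : Grid I N) :
    rank i (.inl a) < rank (N := N) i (.inr j) := by
  simp only [rank, if_neg h]
  have h1 := (Fintype.equivFin (Grid I N) a).2
  have h2 : ((a.1 i : ℕ) + 1) * Fintype.card (Grid I N) ≤ (N + 1) * Fintype.card (Grid I N) :=
    Nat.mul_le_mul_right _ (a.1 i).2
  rw [add_one_mul] at h2
  omega

lemma rank_injective {N : ℕ} (i : I) : Function.Injective (rank (N := N) i) := by
  rintro (a | j) (b | k) h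
  · have hab : a.1 i = b.1 i := by
      rcases lt_trichotomy (a.1 i) (b.1 i) with h' | h' | h'
      · exact absurd h (rank_inl_lt h').ne
      · exact h'
      · exact absurd h (rank_inl_lt h').ne'
    simp only [rank, hab] at h
    exact congrArg _ ((Fintype.equivFin (Grid I N)).injective (Fin.ext (by omega)))
  · by_cases hk : k = i
    · subst hk
      exact absurd h ((rank_inr_self k).trans_lt (rank_inl_pos k a)).ne'
    · exact absurd h (rank_inl_lt_inr hk a).ne
  · by_cases hj : j = i
    · subst hj
      exact absurd h ((rank_inr_self j).trans_lt (rank_inl_pos j b)).ne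
    · exact absurd h (rank_inl_lt_inr hj b).ne'
  · by_cases hj : j = i <;> by_cases hk : k = i
    · rw [hj, hk]
    · simp [rank, hj, hk] at h
      omega
    · simp [rank, hj, hk] at h
    · simp only [rank, if_neg hj, if_neg hk] at h
      exact congrArg _ ((Fintype.equivFin I).injective (Fin.ext (by omega)))

/-- For every coloring of the grid there is a grid point close to points of every color, up to
those colors whose coordinate is small. -/
lemma Grid.exists_almost_colorful (hI : 1 < Fintype.card I) {N : ℕ} (c : Grid I N → I) :
    ∃ a : Grid I N, ∀ i, (a.1 i : ℕ) ≤ Fintype.card I ∨ ∃ b, c b = i ∧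
      ∀ k, (b.1 k : ℕ) ≤ a.1 k + Fintype.card I ∧ (a.1 k : ℕ) ≤ b.1 k + Fintype.card I := by
  obtain ⟨i₁⟩ : Nonempty I := Fintype.card_pos_iff.1 (by omega)
  obtain ⟨t, -⟩ := Grid.exists_coe_eq (N := N) (Pi.single i₁ N) (by simp)
  obtain ⟨σ, hd, hσ⟩ := ScarfDominant.exists_colorful (r := rank (N := N)) (s := Sum.inr)
    (t := Sum.inl t) (c := Sum.elim c id) hI rank_injective
    (fun i x => (rank_inr_self i).trans_le (Nat.zero_le _))
    (by
      rintro (a | k) hx i j hj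
      · exact rank_inl_lt_inr hj a
      · exact absurd ⟨k, rfl⟩ hx)
    (by simp) (fun i => rfl)
  have hin : ∀ i, Sum.inr i ∉ σ → ∃ a, Sum.inl a ∈ σ ∧ c a = i := fun i hi => by
    obtain ⟨a | j, ha, hc⟩ := hσ i
    · exact ⟨a, ha, hc⟩
    · obtain rfl : j = i := hc
      exact absurd ha hi
  have hslack : ∀ (a : Grid I N) i, (∀ x ∈ σ, rank i (.inl a) ≤ rank i x) → Sum.inr i ∉ σ :=
    fun a i h hi => by
      have h1 := h _ hi
      have h2 := rank_inl_pos i a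
      rw [rank_inr_self] at h1
      omega
  obtain ⟨i₂, hi₂⟩ := hd (.inl t)
  obtain ⟨a₀, ha₀, -⟩ := hin i₂ (hslack t i₂ hi₂)
  have hmin : ∀ i, ∃ m : ℕ, (∀ a, Sum.inl a ∈ σ → m ≤ a.1 i) ∧ (Sum.inr i ∈ σ → m = 0) ∧
      (Sum.inr i ∉ σ → ∃ a, Sum.inl a ∈ σ ∧ (a.1 i : ℕ) = m) := fun i => by
    by_cases hi : Sum.inr i ∈ σ
    · exact ⟨0, fun _ _ => Nat.zero_le _, fun _ => rfl, absurd hi⟩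
    obtain ⟨a, ha, hle⟩ := exists_min_image ({a | Sum.inl a ∈ σ} : Finset (Grid I N))
      (fun a => (a.1 i : ℕ)) ⟨a₀, by simpa using ha₀⟩
    exact ⟨a.1 i, fun b hb => hle b (by simpa using hb), fun h => absurd h hi,
      fun _ => ⟨a, by simpa using ha, rfl⟩⟩
  choose m hm hzero hatt using hmin
  have hsum : N < ∑ i, m i + Fintype.card I := by
    by_contra! hN
    obtain ⟨y, hy⟩ := Grid.exists_coe_eq (N := N)
      (fun i => m i + 1 + Pi.single (M := fun _ => ℕ) i₁ (N - (∑ i, m i + Fintype.card I)) i)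
      (by simp [sum_add_distrib]; omega)
    obtain ⟨i, hi⟩ := hd (.inl y)
    obtain ⟨a, ha, hai⟩ := hatt i (hslack y i hi)
    have hlt : a.1 i < y.1 i := by
      rw [Fin.lt_def, hy, hai]
      omega
    exact absurd (hi _ ha) (not_le.2 (rank_inl_lt hlt))
  have hclose : ∀ a, Sum.inl a ∈ σ → ∀ i, (a.1 i : ℕ) ≤ m i + Fintype.card I := fun a ha i => by
    have h1 : ∑ k ∈ univ.erase i, m k ≤ ∑ k ∈ univ.erase i, (a.1 k : ℕ) :=
      sum_le_sum fun k _ => hm k a ha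
    have h2 := add_sum_erase univ m (mem_univ i)
    have h3 := add_sum_erase univ (fun k => (a.1 k : ℕ)) (mem_univ i)
    have h4 := a.2
    omega
  refine ⟨a₀, fun i => ?_⟩
  by_cases hi : Sum.inr i ∈ σ
  · left
    have := hclose a₀ ha₀ i
    rwa [hzero i hi, zero_add] at this
  · right
    obtain ⟨b, hb, hbi⟩ := hin i hi
    refine ⟨b, hbi, fun k => ?_⟩
    have h1 := hclose a₀ ha₀ k
    have h2 := hclose b hb k
    have h3 := hm k a₀ ha₀
    have h4 := hm k b hb
    omega

lemma exists_approx (hI : 1 < Fintype.card I) (g : stdSimplex ℝ I → stdSimplex ℝ I) {N : ℕ}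
    (hN : N ≠ 0) : ∃ p : stdSimplex ℝ I, ∀ i, ∃ q : stdSimplex ℝ I,
      dist q p ≤ Fintype.card I / N ∧ q.1 i ≤ (g q).1 i + Fintype.card I / N := by
  choose c hc using fun p : stdSimplex ℝ I => exists_le p (g p)
  obtain ⟨a, ha⟩ := Grid.exists_almost_colorful hI fun b : Grid I N => c (b.toSimplex hN)
  have hpos : (0 : ℝ) < N := by positivity
  refine ⟨a.toSimplex hN, fun i => ?_⟩
  rcases ha i with h | ⟨b, rfl, hb⟩
  · refine ⟨a.toSimplex hN, by rw [dist_self]; positivity, ?_⟩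
    refine le_add_of_nonneg_of_le ((g _).2.1 i) ?_
    change ((a.1 i : ℕ) : ℝ) / N ≤ _
    gcongr
  · refine ⟨b.toSimplex hN, ?_, (hc _).trans (le_add_of_nonneg_right (by positivity))⟩
    rw [Subtype.dist_eq, dist_pi_le_iff (by positivity)]
    intro k
    change |((b.1 k : ℕ) : ℝ) / N - ((a.1 k : ℕ) : ℝ) / N| ≤ _
    rw [← sub_div, abs_div, abs_of_pos hpos]
    gcongr
    obtain ⟨h1, h2⟩ := hb k
    have h1 : ((b.1 k : ℕ) : ℝ) ≤ (a.1 k : ℕ) + Fintype.card I := mod_cast h1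
    have h2 : ((a.1 k : ℕ) : ℝ) ≤ (b.1 k : ℕ) + Fintype.card I := mod_cast h2
    rw [abs_le]
    constructor <;> linarith

/-- **Brouwer's fixed-point theorem** for the standard simplex. -/
theorem exists_fixedPoint_stdSimplex [Nonempty I] {g : stdSimplex ℝ I → stdSimplex ℝ I}
    (hg : Continuous g) : ∃ p, g p = p := by
  rcases subsingleton_or_nontrivial I with hI | hI
  · obtain ⟨p⟩ : Nonempty (stdSimplex ℝ I) := inferInstance
    exact ⟨p, Subsingleton.elim _ _⟩
  choose p q hdist hle using fun N : ℕ =>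
    exists_approx (Fintype.one_lt_card (α := I)) g (Nat.succ_ne_zero N)
  obtain ⟨x, φ, hφ, hlim⟩ := CompactSpace.tendsto_subseq p
  have hzero : Tendsto (fun N => (Fintype.card I : ℝ) / ((φ N).succ : ℕ)) atTop (𝓝 0) :=
    ((tendsto_const_div_atTop_nhds_zero_nat _).comp (tendsto_add_atTop_nat 1)).comp
      hφ.tendsto_atTop
  have hcoord : ∀ i, Continuous fun y : stdSimplex ℝ I => y.1 i := fun i =>
    (continuous_apply i).comp continuous_subtype_val
  have hx : ∀ i, x.1 i ≤ (g x).1 i := fun i => by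
    have hq : Tendsto (fun N => q (φ N) i) atTop (𝓝 x) := by
      refine (tendsto_iff_of_dist (squeeze_zero (fun _ => dist_nonneg) (fun N => ?_) hzero)).1 hlim
      rw [dist_comm]
      exact hdist (φ N) i
    refine le_of_tendsto_of_tendsto' (((hcoord i).tendsto x).comp hq) ?_ fun N => hle (φ N) i
    simpa using ((((hcoord i).comp hg).tendsto x).comp hq).add hzero
  refine ⟨x, Subtype.ext (funext fun i => ?_)⟩
  exact ((sum_eq_sum_iff_of_le fun i _ => hx i).1 (x.2.2.trans (g x).2.2.symm) i
    (mem_univ i)).symm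

end BrouwerFixedPoint

/-- Brouwer's fixed-point theorem: every continuous map from a geometric `n`-simplex
`δ ⊆ ℝ^d` to itself has a fixed point. -/
theorem brouwer_fixed_point (d n : ℕ)
    (v : Fin (n + 1) → EuclideanSpace ℝ (Fin d)) (hv : AffineIndependent ℝ v)
    (f : EuclideanSpace ℝ (Fin d) → EuclideanSpace ℝ (Fin d))
    (hfc : ContinuousOn f (convexHull ℝ (Set.range v)))
    (hfm : Set.MapsTo f (convexHull ℝ (Set.range v)) (convexHull ℝ (Set.range v))) :
    ∃ x ∈ convexHull ℝ (Set.range v), f x = x := by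
  have himg := BrouwerFixedPoint.convexHull_range_eq_image v
  let e : stdSimplex ℝ (Fin (n + 1)) → convexHull ℝ (Set.range v) :=
    fun w => ⟨∑ i, w.1 i • v i, himg ▸ Set.mem_image_of_mem _ w.2⟩
  have he : Continuous e := by
    refine Continuous.subtype_mk (continuous_finsetSum _ fun i _ => ?_) _
    exact ((continuous_apply i).comp continuous_subtype_val).smul continuous_const
  have hbij : Function.Bijective e := by
    constructor
    · intro w w' h
      have h : ∑ i, w.1 i • v i = ∑ i, w'.1 i • v i := congrArg Subtype.val h
      refine Subtype.ext ((affineIndependent_iff_eq_of_fintype_affineCombination_eq ℝ v).1 hv _ _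
        w.2.2 w'.2.2 ?_)
      rwa [Finset.affineCombination_eq_linear_combination _ _ _ w.2.2,
        Finset.affineCombination_eq_linear_combination _ _ _ w'.2.2]
    · rintro ⟨x, hx⟩
      obtain ⟨w, hw, rfl⟩ := himg ▸ hx
      exact ⟨⟨w, hw⟩, rfl⟩
  let h := Continuous.homeoOfEquivCompactToT2 (f := Equiv.ofBijective e hbij) he
  have hF : Continuous (hfm.restrict f _ _) := hfc.mapsToRestrict hfm
  obtain ⟨p, hp⟩ := BrouwerFixedPoint.exists_fixedPoint_stdSimplex
    (h.symm.continuous.comp (hF.comp h.continuous))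
  exact ⟨h p, (h p).2, congrArg Subtype.val (h.symm_apply_eq.1 hp)⟩
end

section
/- KKM theorem: Let δ ⊆ ℝ^d be a geometric n-simplex with vertices v_0, …, v_n and let F_0, …, F_n be closed subsets of δ such that for every nonempty subset J ⊆ {0, …, n}, the face of δ with vertex set {v_i : i ∈ J} is contained in ⋃_{i ∈ J} F_i. Then the intersection F_0 ∩ F_1 ∩ ⋯ ∩ F_n is nonempty. -/
open Finset in
/-- Among the sets obtained from `S` by deleting one point, the number of those whose image under
`c` is everything except `i₀` is odd if and only if `c` maps `S` bijectively onto its codomain. -/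
theorem odd_card_facets_iff {V I : Type*} [Fintype V] [DecidableEq V] [Fintype I] [DecidableEq I]
    (c : V → I) (i₀ : I) (S : Finset V) (hS : #S = Fintype.card I) :
    Odd #{Q : Finset V | (#Q + 1 = Fintype.card I ∧ Q.image c = univ.erase i₀) ∧ Q ⊆ S} ↔
      S.image c = univ := by
  have hinj : ∀ Q : Finset V, #Q + 1 = Fintype.card I → Q.image c = univ.erase i₀ →
      Set.InjOn c Q := by
    intro Q hQ hc
    rw [← card_image_iff, hc, card_erase_of_mem (mem_univ _), card_univ]
    omega
  constructor
  · intro hodd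
    by_contra hne
    rw [← Nat.not_even_iff_odd] at hodd
    apply hodd
    rcases eq_empty_or_nonempty
      {Q : Finset V | (#Q + 1 = Fintype.card I ∧ Q.image c = univ.erase i₀) ∧ Q ⊆ S} with h | h
    · rw [h]; simp
    obtain ⟨Q, hQ⟩ := h
    simp only [mem_filter, mem_univ, true_and] at hQ
    obtain ⟨⟨hQc, hQi⟩, hQS⟩ := hQ
    obtain ⟨x, hxQ, rfl⟩ : ∃ x, x ∉ Q ∧ insert x Q = S := by
      apply (covBy_iff_exists_insert).1
      exact (covBy_iff_card_sdiff_eq_one).2 ⟨hQS, by rw [card_sdiff_of_subset hQS]; omega⟩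
    have hcx : c x ≠ i₀ := by
      rintro rfl
      apply hne
      rw [image_insert, hQi, insert_erase (mem_univ _)]
    obtain ⟨x', hx'Q, hx'⟩ : ∃ x' ∈ Q, c x' = c x := by
      have : c x ∈ Q.image c := by rw [hQi]; simp [hcx]
      simpa using this
    have hxx' : x ≠ x' := by rintro rfl; exact hxQ hx'Q
    have key : ({Q' : Finset V | (#Q' + 1 = Fintype.card I ∧ Q'.image c = univ.erase i₀) ∧
        Q' ⊆ insert x Q} : Finset (Finset V)) = {Q, (insert x Q).erase x'} := by
      ext Q'
      simp only [mem_filter, mem_univ, true_and, mem_insert, mem_singleton]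
      constructor
      · rintro ⟨⟨h1, h2⟩, h3⟩
        by_cases hx : x ∈ Q'
        · right
          apply eq_of_subset_of_card_le
          · intro z hz
            refine mem_erase.2 ⟨?_, h3 hz⟩
            rintro rfl
            exact hxx' (hinj Q' h1 h2 hx hz hx'.symm)
          · rw [card_erase_of_mem (mem_insert_of_mem hx'Q)]; omega
        · left
          apply eq_of_subset_of_card_le
          · intro z hz
            rcases mem_insert.1 (h3 hz) with rfl | h
            · exact absurd hz hx
            · exact h
          · omega
      · rintro (rfl | rfl)
        · exact ⟨⟨hQc, hQi⟩, hQS⟩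
        · refine ⟨⟨?_, ?_⟩, erase_subset _ _⟩
          · rw [card_erase_of_mem (mem_insert_of_mem hx'Q)]; omega
          · rw [← hQi]
            ext j
            simp only [mem_image, mem_erase, mem_insert]
            constructor
            · rintro ⟨z, ⟨hz, rfl | hzQ⟩, rfl⟩
              · exact ⟨x', hx'Q, hx'⟩
              · exact ⟨z, hzQ, rfl⟩
            · rintro ⟨z, hz, rfl⟩
              by_cases hzx : z = x'
              · exact ⟨x, ⟨hxx', Or.inl rfl⟩, by rw [hzx, hx']⟩
              · exact ⟨z, ⟨hzx, Or.inr hz⟩, rfl⟩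
    rw [key, card_pair]
    · simp
    · intro h
      rw [h] at hx'Q
      simp at hx'Q
  · intro hfull
    have hSi : Set.InjOn c S := by
      rw [← card_image_iff, hfull, card_univ, hS]
    obtain ⟨x, hxS, hx⟩ : ∃ x ∈ S, c x = i₀ := by
      have : i₀ ∈ S.image c := by rw [hfull]; simp
      simpa using this
    have key : ({Q' : Finset V | (#Q' + 1 = Fintype.card I ∧ Q'.image c = univ.erase i₀) ∧
        Q' ⊆ S} : Finset (Finset V)) = {S.erase x} := by
      ext Q'
      simp only [mem_filter, mem_univ, true_and, mem_singleton]
      constructor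
      · rintro ⟨⟨h1, h2⟩, h3⟩
        apply eq_of_subset_of_card_le
        · intro z hz
          refine mem_erase.2 ⟨?_, h3 hz⟩
          rintro rfl
          have : c z ∈ Q'.image c := mem_image_of_mem _ hz
          rw [h2, hx] at this
          simp at this
        · rw [card_erase_of_mem hxS]; omega
      · rintro rfl
        refine ⟨⟨?_, ?_⟩, erase_subset _ _⟩
        · rw [card_erase_of_mem hxS]
          have := card_pos.2 ⟨x, hxS⟩
          omega
        · ext j
          simp only [mem_image, mem_erase, mem_univ, and_true]
          constructor
          · rintro ⟨z, ⟨hz, hzS⟩, rfl⟩ h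
            exact hz (hSi hzS hxS (h.trans hx.symm))
          · intro hj
            have : j ∈ S.image c := by rw [hfull]; simp
            obtain ⟨z, hz, rfl⟩ := mem_image.1 this
            exact ⟨z, ⟨by rintro rfl; exact hj hx, hz⟩, rfl⟩
    rw [key]; simp

open Finset in
/-- Sperner's lemma for closed pseudomanifolds: if every set with one point less lies in an even
number of members of `R`, then the number of members of `R` receiving all colours is even. -/
theorem even_card_rainbow {V I : Type*} [Fintype V] [DecidableEq V] [Fintype I] [DecidableEq I]
    [Nonempty I] (c : V → I) (R : Finset (Finset V)) (hR : ∀ S ∈ R, #S = Fintype.card I)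
    (heven : ∀ Q : Finset V, #Q + 1 = Fintype.card I → Even #{S ∈ R | Q ⊆ S}) :
    Even #{S ∈ R | S.image c = univ} := by
  obtain ⟨i₀⟩ := ‹Nonempty I›
  have h := sum_card_bipartiteAbove_eq_sum_card_bipartiteBelow
    (s := {Q : Finset V | #Q + 1 = Fintype.card I ∧ Q.image c = univ.erase i₀}) (t := R)
    (fun Q S => Q ⊆ S)
  have h1 : Even (∑ S ∈ R, #(bipartiteBelow (fun Q S : Finset V => Q ⊆ S)
      {Q : Finset V | #Q + 1 = Fintype.card I ∧ Q.image c = univ.erase i₀} S)) := by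
    rw [← h]
    refine even_sum _ fun Q hQ => heven Q ?_
    simp only [mem_filter, mem_univ, true_and] at hQ
    exact hQ.1
  rw [even_sum_iff_even_card_odd] at h1
  convert h1 using 2
  refine filter_congr fun S hS => ?_
  rw [← odd_card_facets_iff c i₀ S (hR S hS), bipartiteBelow, filter_filter]

/-- A set `S` dominates with respect to the rankings `r i` if no point is ranked, for every `i`,
strictly above the `i`-lowest point of `S`. -/
def Dominates {V I L : Type*} [LinearOrder L] (r : I → V → L) (S : Finset V) : Prop :=
  ∀ y, ∃ i, ∀ x ∈ S, r i y ≤ r i x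

theorem Dominates.mono {V I L : Type*} [LinearOrder L] {r : I → V → L} {S Q : Finset V}
    (hS : Dominates r S) (h : Q ⊆ S) : Dominates r Q := fun y =>
  (hS y).imp fun _ hi x hx => hi x (h hx)

open Finset in
/-- Let `m i` be the `i`-lowest point of the dominating set `Q` and suppose `m a = m b`. If some
point beats `m i` for all `i ≠ a`, then the `a`-highest such point extends `Q` to a dominating
set. -/
theorem Dominates.exists_insert {V I L : Type*} [Fintype V] [DecidableEq V] [LinearOrder L]
    {r : I → V → L} (hr : ∀ i, Function.Injective (r i)) {Q : Finset V} (hQ : Dominates r Q)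
    (m : I → V) (hmQ : ∀ i, m i ∈ Q) (hm : ∀ i, ∀ x ∈ Q, r i (m i) ≤ r i x) {a b : I}
    (hab : a ≠ b) (hmab : m a = m b) (hM : ∃ y, ∀ i, i ≠ a → r i (m i) < r i y) :
    ∃ x, x ∉ Q ∧ (∀ i, i ≠ a → r i (m i) < r i x) ∧
      (∀ y, (∀ i, i ≠ a → r i (m i) < r i y) → r a y ≤ r a x) ∧ Dominates r (insert x Q) := by
  classical
  obtain ⟨x, hx, hmax⟩ := exists_max_image {y : V | ∀ i, i ≠ a → r i (m i) < r i y} (r a)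
    (by simpa [Finset.Nonempty] using hM)
  simp only [mem_filter, mem_univ, true_and] at hx hmax
  refine ⟨x, ?_, hx, hmax, ?_⟩
  · intro hxQ
    obtain ⟨i, hi⟩ := hQ x
    by_cases hia : i = a
    · subst hia
      have h1 := hr i (le_antisymm (hi _ (hmQ i)) (hm i x hxQ))
      have h2 := hx b hab.symm
      rw [h1, hmab] at h2
      exact lt_irrefl _ h2
    · exact absurd (hx i hia) (not_lt.2 (hi _ (hmQ i)))
  · intro y
    by_contra! hy
    have hya : ∀ i, i ≠ a → r i (m i) < r i y := by
      intro i hi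
      obtain ⟨z, hz, hzy⟩ := hy i
      rcases mem_insert.1 hz with rfl | hz
      · exact (hx i hi).trans hzy
      · exact (hm i z hz).trans_lt hzy
    obtain ⟨z, hz, hzy⟩ := hy a
    rcases mem_insert.1 hz with rfl | hz
    · exact absurd hzy (not_lt.2 (hmax y hya))
    · obtain ⟨i, hi⟩ := hQ y
      by_cases hia : i = a
      · subst hia
        exact absurd hzy (not_lt.2 (hi z hz))
      · exact absurd (hya i hia) (not_lt.2 (hi _ (hmQ i)))

open Finset in
/-- A dominating set with as many points as there are rankings has every point `i`-lowest for
exactly one `i`. -/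
theorem Dominates.exists_lowest_index {V I L : Type*} [DecidableEq V] [Fintype I] [LinearOrder L]
    {r : I → V → L} (hr : ∀ i, Function.Injective (r i)) {Q : Finset V} {z : V} (hz : z ∉ Q)
    (hc : #Q + 1 = Fintype.card I) (hS : Dominates r (insert z Q))
    (m : I → V) (hmQ : ∀ i, m i ∈ Q) (hm : ∀ i, ∀ x ∈ Q, r i (m i) ≤ r i x) {a b : I}
    (hab : a ≠ b) (hmab : m a = m b) :
    ∃ i, (i = a ∨ i = b) ∧ (∀ j, j ≠ i → r j (m j) < r j z) ∧
      ∀ y, (∀ j, j ≠ i → r j (m j) < r j y) → r i y ≤ r i z := by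
  choose f hf using hS
  have hfinj : Set.InjOn f (insert z Q : Finset V) := by
    intro x hx y hy hxy
    apply hr (f x)
    refine le_antisymm (hf x y hy) ?_
    rw [hxy]
    exact hf y x hx
  have hsurj : ∀ i, ∃ x ∈ insert z Q, f x = i := by
    classical
    have : (insert z Q).image f = univ := by
      rw [← card_eq_iff_eq_univ, card_image_of_injOn hfinj, card_insert_of_notMem hz, hc]
    intro i
    have h : i ∈ (insert z Q).image f := by rw [this]; exact mem_univ i
    simpa only [mem_image] using h
  have hother : ∀ j, j ≠ f z → r j (m j) < r j z ∧ f (m j) = j := by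
    intro j hj
    obtain ⟨x, hx, rfl⟩ := hsurj j
    rcases mem_insert.1 hx with rfl | hxQ
    · exact absurd rfl hj
    have hxm : m (f x) = x :=
      hr (f x) (le_antisymm (hm _ x hxQ) (hf x _ (mem_insert_of_mem (hmQ _))))
    rw [hxm]
    refine ⟨lt_of_le_of_ne (hf x z (mem_insert_self _ _)) fun h => ?_, rfl⟩
    exact hz (hr _ h ▸ hxQ)
  refine ⟨f z, ?_, fun j hj => (hother j hj).1, ?_⟩
  · by_contra! h
    apply hab
    rw [← (hother a h.1.symm).2, ← (hother b h.2.symm).2, hmab]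
  · intro y hy
    by_cases h : f y = f z
    · rw [← h]
      exact hf y z (mem_insert_self _ _)
    · exact absurd (hy _ h) (not_lt.2 (hf y _ (mem_insert_of_mem (hmQ _))))

open Finset in
/-- A dominating set with one point less than there are rankings, and which satisfies the
nondegeneracy condition `hM`, is contained in an even number of dominating sets with one more point. -/
theorem even_card_dominates_insert {V I L : Type*} [Fintype V] [DecidableEq V] [Fintype I]
    [LinearOrder L] {r : I → V → L} (hr : ∀ i, Function.Injective (r i)) {Q : Finset V}
    (hQne : Q.Nonempty) (hc : #Q + 1 = Fintype.card I)
    (hM : ∀ a, ∃ y, ∀ i, i ≠ a → ∃ x ∈ Q, r i x < r i y) (R : Finset (Finset V))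
    (hR : ∀ S, S ∈ R ↔ Q ⊆ S ∧ #S = Fintype.card I ∧ Dominates r S) :
    Even #R := by
  rcases R.eq_empty_or_nonempty with rfl | ⟨S₀, hS₀⟩
  · simp
  have hQ : Dominates r Q := ((hR S₀).1 hS₀).2.2.mono ((hR S₀).1 hS₀).1
  have hex : ∀ i, ∃ x ∈ Q, ∀ y ∈ Q, r i x ≤ r i y := fun i => exists_min_image Q (r i) hQne
  choose m hmQ hm using hex
  obtain ⟨a, -, b, -, hab, hmab⟩ := exists_ne_map_eq_of_card_lt_of_maps_to
    (s := (univ : Finset I)) (t := Q) (f := m) (by rw [card_univ]; omega) (fun i _ => hmQ i)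
  have hM' : ∀ a, ∃ y, ∀ i, i ≠ a → r i (m i) < r i y := by
    intro a
    obtain ⟨y, hy⟩ := hM a
    refine ⟨y, fun i hi => ?_⟩
    obtain ⟨x, hx, hxy⟩ := hy i hi
    exact (hm i x hx).trans_lt hxy
  obtain ⟨x, hxQ, hx, hxmax, hxS⟩ := hQ.exists_insert hr m hmQ hm hab hmab (hM' a)
  obtain ⟨y, hyQ, hy, hymax, hyS⟩ := hQ.exists_insert hr m hmQ hm hab.symm hmab.symm (hM' b)
  have hxy : x ≠ y := by
    rintro rfl
    obtain ⟨i, hi⟩ := hQ x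
    by_cases hia : i = a
    · exact absurd (hy i (hia ▸ hab)) (not_lt.2 (hi _ (hmQ i)))
    · exact absurd (hx i hia) (not_lt.2 (hi _ (hmQ i)))
  have key : R = {insert x Q, insert y Q} := by
    ext S
    rw [hR, mem_insert, mem_singleton]
    constructor
    · rintro ⟨hQS, hSc, hS⟩
      obtain ⟨z, hzQ, rfl⟩ : ∃ z, z ∉ Q ∧ insert z Q = S := by
        apply (covBy_iff_exists_insert).1
        exact (covBy_iff_card_sdiff_eq_one).2 ⟨hQS, by rw [card_sdiff_of_subset hQS]; omega⟩
      obtain ⟨i, rfl | rfl, hi, himax⟩ :=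
        hS.exists_lowest_index hr hzQ hc m hmQ hm hab hmab
      · left
        rw [hr i (le_antisymm (himax x hx) (hxmax z hi))]
      · right
        rw [hr i (le_antisymm (himax y hy) (hymax z hi))]
    · rintro (rfl | rfl)
      · exact ⟨subset_insert _ _, by rw [card_insert_of_notMem hxQ, hc], hxS⟩
      · exact ⟨subset_insert _ _, by rw [card_insert_of_notMem hyQ, hc], hyS⟩
  rw [key, card_pair]
  · simp
  · intro h
    have : x ∈ insert y Q := h ▸ mem_insert_self x Q
    rcases mem_insert.1 this with h | h
    · exact hxy h
    · exact hxQ h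

open Finset in
/-- Deleting one slack point `s k` from the set of all slack points leaves a set which is contained
in exactly one dominating set of the original size. -/
theorem exists_dominates_iff_of_slack {V I L : Type*} [Fintype V] [DecidableEq V] [Fintype I]
    [DecidableEq I] [LinearOrder L] {r : I → V → L} (hr : ∀ i, Function.Injective (r i))
    {s : I → V} (hs : Function.Injective s) (hlow : ∀ i x, x ≠ s i → r i (s i) < r i x)
    (hhigh : ∀ i j x, j ≠ i → (∀ k, x ≠ s k) → r i x < r i (s j)) (hne : ∃ x, ∀ k, x ≠ s k)
    (k : I) :
    ∃ x, (∀ j, x ≠ s j) ∧ ∀ z, z ∉ (univ.erase k).image s →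
      (Dominates r (insert z ((univ.erase k).image s)) ↔ z = x) := by
  obtain ⟨x, hx, hmax⟩ := exists_max_image {x : V | ∀ k, x ≠ s k} (r k)
    (by simpa [Finset.Nonempty] using hne)
  simp only [mem_filter, mem_univ, true_and] at hx hmax
  refine ⟨x, hx, fun z hz => ⟨fun h => ?_, ?_⟩⟩
  · obtain ⟨i, hi⟩ := h x
    have hik : i = k := by
      by_contra hik
      exact absurd (hlow i x (hx i)) (not_lt.2 (hi (s i) (by simp [hs.eq_iff, hik])))
    subst hik
    by_cases hzs : ∀ j, z ≠ s j
    · exact hr i (le_antisymm (hmax z hzs) (hi z (mem_insert_self _ _)))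
    · push Not at hzs
      obtain ⟨j, rfl⟩ := hzs
      have hj : j = i := by
        by_contra hj
        exact hz (by simp [hs.eq_iff, hj])
      subst hj
      exact absurd (hlow j x (hx j)) (not_lt.2 (hi _ (mem_insert_self _ _)))
  · rintro rfl y
    by_cases hy : ∀ j, y ≠ s j
    · refine ⟨k, fun w hw => ?_⟩
      rcases mem_insert.1 hw with rfl | hw
      · exact hmax y hy
      · obtain ⟨j, hj, rfl⟩ := mem_image.1 hw
        exact (hhigh k j y (ne_of_mem_erase hj) hy).le
    · push Not at hy
      obtain ⟨j, rfl⟩ := hy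
      refine ⟨j, fun w _ => ?_⟩
      by_cases hw : w = s j
      · rw [hw]
      · exact (hlow j w hw).le

open Finset in
/-- Scarf's lemma: if the slack point `s i` is lowest in the `i`-th ranking and higher than every
non-slack point in the other rankings, then any colouring with `c (s i) = i` admits a dominating
set containing each colour exactly once. -/
theorem exists_dominates_rainbow {V I L : Type*} [Fintype V] [DecidableEq V] [Fintype I]
    [DecidableEq I] [Nonempty I] [LinearOrder L] {r : I → V → L}
    (hr : ∀ i, Function.Injective (r i))
    {s : I → V} (hlow : ∀ i x, x ≠ s i → r i (s i) < r i x)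
    (hhigh : ∀ i j x, j ≠ i → (∀ k, x ≠ s k) → r i x < r i (s j)) (hne : ∃ x, ∀ k, x ≠ s k)
    (c : V → I) (hcs : ∀ i, c (s i) = i) :
    ∃ S : Finset V, Dominates r S ∧ S.image c = univ := by
  classical
  have hs : Function.Injective s := fun i j h => by rw [← hcs i, ← hcs j, h]
  have hslack : ¬ Dominates r (univ.image s) := by
    intro h
    obtain ⟨x, hx⟩ := hne
    obtain ⟨i, hi⟩ := h x
    exact absurd (hlow i x (hx i)) (not_lt.2 (hi _ (mem_image_of_mem s (mem_univ i))))
  have hcard : #(univ.image s) = Fintype.card I := by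
    rw [card_image_of_injective _ hs, card_univ]
  set R : Finset (Finset V) :=
    {S | #S = Fintype.card I ∧ (Dominates r S ∨ S = univ.image s)} with hRdef
  have heven : Even #{S ∈ R | S.image c = univ} := by
    refine even_card_rainbow c R (fun S hS => by simp [hRdef] at hS; exact hS.1) fun Q hQ => ?_
    by_cases hQs : Q ⊆ univ.image s
    · obtain ⟨k, rfl⟩ : ∃ k, Q = (univ.erase k).image s := by
        obtain ⟨z, hz, hzQ⟩ : ∃ z, z ∉ Q ∧ insert z Q = univ.image s := by
          apply (covBy_iff_exists_insert).1
          exact (covBy_iff_card_sdiff_eq_one).2 ⟨hQs, by rw [card_sdiff_of_subset hQs]; omega⟩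
        have : z ∈ univ.image s := hzQ ▸ mem_insert_self z Q
        obtain ⟨k, -, rfl⟩ := mem_image.1 this
        refine ⟨k, ?_⟩
        rw [← erase_insert hz, hzQ, image_erase hs]
      obtain ⟨x, hx, hiff⟩ := exists_dominates_iff_of_slack hr hs hlow hhigh hne k
      have hxQ : x ∉ (univ.erase k).image s := by
        intro h
        obtain ⟨j, -, hj⟩ := mem_image.1 h
        exact hx j hj.symm
      have key : ({S ∈ R | (univ.erase k).image s ⊆ S} : Finset (Finset V)) =
          {insert x ((univ.erase k).image s), univ.image s} := by
        ext S
        simp only [hRdef, mem_filter, mem_univ, true_and, mem_insert, mem_singleton]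
        constructor
        · rintro ⟨⟨hSc, hS | hS⟩, hQS⟩
          · left
            obtain ⟨z, hzQ, rfl⟩ : ∃ z, z ∉ (univ.erase k).image s ∧
                insert z ((univ.erase k).image s) = S := by
              apply (covBy_iff_exists_insert).1
              exact (covBy_iff_card_sdiff_eq_one).2
                ⟨hQS, by rw [card_sdiff_of_subset hQS]; omega⟩
            rw [(hiff z hzQ).1 hS]
          · exact Or.inr hS
        · rintro (rfl | rfl)
          · exact ⟨⟨by rw [card_insert_of_notMem hxQ, hQ], Or.inl ((hiff x hxQ).2 rfl)⟩,
              subset_insert _ _⟩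
          · exact ⟨⟨hcard, Or.inr rfl⟩, hQs⟩
      rw [key, card_pair]
      · simp
      · intro h
        have : x ∈ univ.image s := h ▸ mem_insert_self x _
        obtain ⟨j, -, hj⟩ := mem_image.1 this
        exact hx j hj.symm
    · obtain ⟨x, hxQ, hx⟩ := not_subset.1 hQs
      have hx' : ∀ k, x ≠ s k := fun k h => hx (h ▸ mem_image_of_mem s (mem_univ k))
      refine even_card_dominates_insert hr ⟨x, hxQ⟩ hQ
        (fun a => ⟨s a, fun i hi => ⟨x, hxQ, hhigh i a x hi.symm hx'⟩⟩) _ fun S => ?_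
      simp only [hRdef, mem_filter, mem_univ, true_and]
      constructor
      · rintro ⟨⟨hSc, hS | rfl⟩, hQS⟩
        · exact ⟨hQS, hSc, hS⟩
        · exact absurd hQS hQs
      · rintro ⟨hQS, hSc, hS⟩
        exact ⟨⟨hSc, Or.inl hS⟩, hQS⟩
  have hmem : univ.image s ∈ ({S ∈ R | S.image c = univ} : Finset (Finset V)) := by
    simp only [hRdef, mem_filter, mem_univ, true_and]
    refine ⟨⟨hcard, by simp⟩, ?_⟩
    ext i
    simp [hcs]
  obtain ⟨S, hS, hSne⟩ := exists_mem_ne (s := {S ∈ R | S.image c = univ}) (by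
    have := card_pos.2 ⟨_, hmem⟩
    obtain ⟨t, ht⟩ := heven
    omega) (univ.image s)
  simp only [hRdef, mem_filter, mem_univ, true_and] at hS
  exact ⟨S, hS.1.2.resolve_right hSne, hS.2⟩

/-- Coordinates on the grid of nonnegative integer points with sum `N`, extended by one slack point
for each coordinate. -/
def gridCoord {I : Type*} [Fintype I] [DecidableEq I] (N : ℕ) (i : I) :
    Finset.piAntidiag (Finset.univ : Finset I) N ⊕ I → ℤ
  | .inl x => x.1 i
  | .inr j => if j = i then -1 else N + 1

open Finset in
/-- Discrete covering lemma: for every colouring of the grid of nonnegative integer points with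
sum `N` there is a grid point `x` such that each colour `i` with `x i` large occurs near `x`. -/
theorem exists_grid_point {I : Type*} [Fintype I] [DecidableEq I] [Nonempty I] (N : ℕ)
    (c : (I → ℕ) → I) :
    ∃ x : I → ℕ, ∑ i, x i = N ∧ ∀ i, x i ≤ Fintype.card I ∨
      ∃ y : I → ℕ, ∑ j, y j = N ∧ c y = i ∧
        ∀ j, x j ≤ y j + Fintype.card I ∧ y j ≤ x j + Fintype.card I := by
  classical
  let T := piAntidiag (univ : Finset I) N
  have hT : ∀ x : I → ℕ, x ∈ T ↔ ∑ i, x i = N := fun x => by simp [T]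
  let V := T ⊕ I
  let e : V → ℕ := fun v => (Fintype.equivFin V v : ℕ)
  have he : Function.Injective e := fun v w h => (Fintype.equivFin V).injective (Fin.ext h)
  let r : I → V → ℤ ×ₗ ℕ := fun i v => toLex (gridCoord N i v, e v)
  have hlt : ∀ i v w, gridCoord N i v < gridCoord N i w → r i v < r i w := fun i v w h =>
    Prod.Lex.toLex_lt_toLex.2 (Or.inl h)
  have hle : ∀ i v w, r i v ≤ r i w → gridCoord N i v ≤ gridCoord N i w := fun i v w h =>
    not_lt.1 fun h' => absurd (hlt i w v h') (not_lt.2 h)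
  have hr : ∀ i, Function.Injective (r i) := fun i v w h =>
    he (Prod.ext_iff.1 (toLex.injective h)).2
  have hTle : ∀ (x : T) i, x.1 i ≤ N := fun x i => by
    have := (hT x.1).1 x.2
    rw [← this]
    exact single_le_sum (f := x.1) (fun _ _ => Nat.zero_le _) (mem_univ i)
  obtain ⟨i₀⟩ := ‹Nonempty I›
  have hTne : (Pi.single i₀ N : I → ℕ) ∈ T := (hT _).2 (by simp)
  obtain ⟨S, hS, hSc⟩ := exists_dominates_rainbow (r := r) (s := (Sum.inr : I → V)) hr
    (fun i v hv => hlt _ _ _ (by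
      rcases v with x | j
      · simp only [gridCoord, if_true]; omega
      · have : j ≠ i := fun h => hv (by rw [h])
        simp only [gridCoord, if_true, if_neg this]; omega))
    (fun i j v hj hv => hlt _ _ _ (by
      rcases v with x | k
      · have := hTle x i
        simp only [gridCoord, if_neg hj]; omega
      · exact absurd rfl (hv k)))
    ⟨Sum.inl ⟨_, hTne⟩, fun k => by simp⟩
    (Sum.elim (fun x => c x.1) id) (fun i => rfl)
  let C : Finset I := {i | (Sum.inr i : V) ∉ S}
  have hC : ∀ i, i ∉ C → (Sum.inr i : V) ∈ S := fun i hi => by simpa [C] using hi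
  have hcol : ∀ i ∈ C, ∃ x : T, Sum.inl x ∈ S ∧ c x.1 = i := by
    intro i hi
    have : i ∈ S.image (Sum.elim (fun x : T => c x.1) id) := by rw [hSc]; exact mem_univ i
    obtain ⟨x | j, hx, hxi⟩ := mem_image.1 this
    · exact ⟨x, hx, hxi⟩
    · simp only [Sum.elim_inr, id] at hxi
      subst hxi
      simp [C, hx] at hi
  have hdom : ∀ y : T, ∃ i ∈ C, ∀ x : T, Sum.inl x ∈ S → y.1 i ≤ x.1 i := by
    intro y
    obtain ⟨i, hi⟩ := hS (Sum.inl y)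
    refine ⟨i, ?_, fun x hx => ?_⟩
    · by_contra hiC
      have := hle _ _ _ (hi _ (hC i hiC))
      simp only [gridCoord, if_true] at this
      omega
    · have := hle _ _ _ (hi _ hx)
      simp only [gridCoord] at this
      omega
  obtain ⟨i₁, hi₁, -⟩ := hdom ⟨_, hTne⟩
  obtain ⟨x₀, hx₀, -⟩ := hcol i₁ hi₁
  have hmin : ∀ i, ∃ x : T, Sum.inl x ∈ S ∧ ∀ y : T, Sum.inl y ∈ S → x.1 i ≤ y.1 i := by
    intro i
    obtain ⟨x, hx, hm⟩ := exists_min_image ({x : T | Sum.inl x ∈ S} : Finset T) (fun x => x.1 i)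
      ⟨x₀, by simpa using hx₀⟩
    exact ⟨x, by simpa using hx, fun y hy => hm y (by simpa using hy)⟩
  choose m hmS hm using hmin
  have hsum : N < ∑ i ∈ C, ((m i).1 i + 1) := by
    by_contra! h
    let y : I → ℕ := fun i => (if i ∈ C then (m i).1 i + 1 else 0) +
      if i = i₁ then N - ∑ i ∈ C, ((m i).1 i + 1) else 0
    have hy : y ∈ T := by
      rw [hT]
      simp only [y, sum_add_distrib, sum_ite_mem, univ_inter, sum_ite_eq', mem_univ, if_true]
      rw [← sum_add_distrib]
      omega
    obtain ⟨i, hi, hyi⟩ := hdom ⟨y, hy⟩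
    have := hyi (m i) (hmS i)
    simp only [y, if_pos hi] at this
    omega
  have hbound : ∀ (x : T), Sum.inl x ∈ S → ∀ i,
      x.1 i ≤ (if i ∈ C then (m i).1 i else 0) + Fintype.card I := by
    intro x hx i
    have h1 : ∑ j, x.1 j = N := (hT _).1 x.2
    have h2 : ∑ j ∈ C, ((m j).1 j + 1) ≤ ∑ j, (if j ∈ C then (m j).1 j else 0) + Fintype.card I := by
      rw [sum_add_distrib, sum_ite_mem, univ_inter]
      simpa using card_le_univ C
    have h3 : ∀ j, (if j ∈ C then (m j).1 j else 0) ≤ x.1 j := by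
      intro j
      split_ifs
      · exact hm j x hx
      · exact Nat.zero_le _
    rw [← add_sum_erase _ _ (mem_univ i)] at h1 h2
    have h4 := sum_le_sum fun j (_ : j ∈ univ.erase i) => h3 j
    omega
  refine ⟨x₀.1, (hT _).1 x₀.2, fun i => ?_⟩
  by_cases hi : i ∈ C
  · right
    obtain ⟨y, hy, hyi⟩ := hcol i hi
    refine ⟨y.1, (hT _).1 y.2, hyi, fun j => ?_⟩
    have h1 := hbound x₀ hx₀ j
    have h2 := hbound y hy j
    have h3 := hm j x₀ hx₀
    have h4 := hm j y hy
    split_ifs at h1 h2 <;> omega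
  · left
    simpa [hi] using hbound x₀ hx₀ i

open Filter Topology in
/-- If closed sets `A i` cover the standard simplex, then some point of the simplex lies in `A i`
for every `i` in its support. -/
theorem exists_mem_of_stdSimplex_subset_iUnion {I : Type*} [Fintype I] [Nonempty I]
    (A : I → Set (I → ℝ)) (hA : ∀ i, IsClosed (A i)) (hcov : stdSimplex ℝ I ⊆ ⋃ i, A i) :
    ∃ x ∈ stdSimplex ℝ I, ∀ i, 0 < x i → x ∈ A i := by
  classical
  let ε : ℕ → ℝ := fun N => Fintype.card I / ((N : ℝ) + 1)
  have hε : Tendsto ε atTop (𝓝 0) := by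
    simpa [ε, div_eq_mul_inv] using
      (tendsto_one_div_add_atTop_nhds_zero_nat (𝕜 := ℝ)).const_mul (Fintype.card I : ℝ)
  have happrox : ∀ N : ℕ, ∃ x ∈ stdSimplex ℝ I, ∀ i, x i ≤ ε N ∨
      ∃ y ∈ A i, dist y x ≤ ε N := by
    intro N
    let g : (I → ℕ) → I → ℝ := fun x i => x i / ((N : ℝ) + 1)
    have hN : (0 : ℝ) < (N : ℝ) + 1 := by positivity
    have hg : ∀ x : I → ℕ, ∑ i, x i = N + 1 → g x ∈ stdSimplex ℝ I := by
      intro x hx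
      refine ⟨fun i => by positivity, ?_⟩
      simp only [g]
      rw [← Finset.sum_div, div_eq_one_iff_eq hN.ne']
      exact_mod_cast hx
    have hcol : ∀ x : I → ℕ, ∃ i, ∑ i, x i = N + 1 → g x ∈ A i := by
      intro x
      by_cases hx : ∑ i, x i = N + 1
      · obtain ⟨i, hi⟩ := Set.mem_iUnion.1 (hcov (hg x hx))
        exact ⟨i, fun _ => hi⟩
      · exact ⟨Classical.arbitrary I, fun h => absurd h hx⟩
    choose c hc using hcol
    obtain ⟨x, hx, h⟩ := exists_grid_point (N + 1) c
    refine ⟨g x, hg x hx, fun i => ?_⟩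
    rcases h i with h | ⟨y, hy, rfl, hyx⟩
    · left
      simp only [g, ε]
      gcongr
    · right
      refine ⟨g y, hc y hy, (dist_pi_le_iff (by positivity)).2 fun j => ?_⟩
      simp only [g, ε]
      rw [Real.dist_eq, ← sub_div, abs_div, abs_of_pos hN]
      gcongr
      obtain ⟨h1, h2⟩ := hyx j
      rw [abs_le]
      have h1' : (x j : ℝ) ≤ y j + Fintype.card I := by exact_mod_cast h1
      have h2' : (y j : ℝ) ≤ x j + Fintype.card I := by exact_mod_cast h2
      constructor <;> linarith
  choose u hu huA using happrox
  obtain ⟨x, hx, φ, hφ, hlim⟩ := (isCompact_stdSimplex ℝ I).tendsto_subseq hu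
  refine ⟨x, hx, fun i hi => ?_⟩
  have hεφ : Tendsto (ε ∘ φ) atTop (𝓝 0) := hε.comp hφ.tendsto_atTop
  have hcoord : Tendsto (fun N => (u (φ N)) i) atTop (𝓝 (x i)) :=
    ((continuous_apply i).tendsto x).comp hlim
  rw [← (hA i).closure_eq, Metric.mem_closure_iff]
  intro δ hδ
  obtain ⟨N, h1, h2, h3⟩ := ((hcoord.eventually (lt_mem_nhds (half_lt_self hi))).and
    ((hεφ.eventually (gt_mem_nhds (lt_min (half_pos hi) (half_pos hδ)))).and
      (Metric.tendsto_nhds.1 hlim (δ / 2) (half_pos hδ)))).exists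
  simp only [Function.comp_apply] at h2 h3
  rw [lt_min_iff] at h2
  rcases huA (φ N) i with h | ⟨y, hy, hyd⟩
  · linarith [h2.1]
  · refine ⟨y, hy, ?_⟩
    have := dist_triangle_left x y (u (φ N))
    rw [dist_comm y] at hyd
    linarith [h2.2]

/-- KKM theorem: if `F 0, …, F n` are closed subsets of the geometric `n`-simplex `δ`
with vertices `v 0, …, v n` such that every face of `δ` is contained in the union of
the sets `F i` indexed by the vertices of that face, then `F 0, …, F n` have a common
point. -/
theorem kkm_theorem (d n : ℕ)
    (v : Fin (n + 1) → EuclideanSpace ℝ (Fin d)) (hv : AffineIndependent ℝ v)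
    (F : Fin (n + 1) → Set (EuclideanSpace ℝ (Fin d)))
    (hFc : ∀ i, IsClosed (F i))
    (hFsub : ∀ i, F i ⊆ convexHull ℝ (Set.range v))
    (hKKM : ∀ J : Finset (Fin (n + 1)), J.Nonempty →
      convexHull ℝ (v '' ↑J) ⊆ ⋃ i ∈ J, F i) :
    (⋂ i, F i).Nonempty := by
  have hne : ∀ i, (F i).Nonempty := fun i => by
    have := hKKM {i} (Finset.singleton_nonempty i) (subset_convexHull ℝ _ ⟨i, by simp, rfl⟩)
    exact ⟨v i, by simpa using this⟩
  let p : (Fin (n + 1) → ℝ) → EuclideanSpace ℝ (Fin d) := fun w => ∑ i, w i • v i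
  have hp : Continuous p := by fun_prop
  let D : Fin (n + 1) → (Fin (n + 1) → ℝ) → ℝ := fun i w => Metric.infDist (p w) (F i)
  have hD : ∀ i, Continuous (D i) := fun i => (Metric.continuous_infDist_pt (F i)).comp hp
  have hD0 : ∀ i w, 0 ≤ D i w := fun i w => Metric.infDist_nonneg
  obtain ⟨w, hw, hwA⟩ := exists_mem_of_stdSimplex_subset_iUnion
    (fun i => {w | w i * ∑ j, D j w ≤ D i w})
    (fun i => isClosed_le (by fun_prop) (hD i)) (fun w hw => by
      by_contra! h
      simp only [Set.mem_iUnion, Set.mem_ofPred_eq, not_exists, not_le] at h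
      have := Finset.sum_lt_sum_of_nonempty Finset.univ_nonempty fun i _ => h i
      rw [← Finset.sum_mul, hw.2, one_mul] at this
      exact lt_irrefl _ this)
  let J : Finset (Fin (n + 1)) := {i | 0 < w i}
  have hJ0 : ∀ i, i ∉ J → w i = 0 := fun i hi =>
    le_antisymm (by simpa [J] using hi) (hw.1 i)
  have hJsum : ∑ i ∈ J, w i = 1 := by
    rw [← hw.2]
    exact Finset.sum_subset (Finset.subset_univ _) fun i _ hi => hJ0 i hi
  have hJ : J.Nonempty := by
    rw [Finset.nonempty_iff_ne_empty]
    intro h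
    simp [h] at hJsum
  have hpJ : p w ∈ convexHull ℝ (v '' ↑J) := by
    have : p w = ∑ i ∈ J, w i • v i :=
      (Finset.sum_subset (Finset.subset_univ _) fun i _ hi => by rw [hJ0 i hi, zero_smul]).symm
    rw [this]
    exact (convex_convexHull ℝ _).sum_mem (fun i _ => hw.1 i) hJsum
      fun i hi => subset_convexHull ℝ _ ⟨i, hi, rfl⟩
  obtain ⟨i, hiJ, hi⟩ := Set.mem_iUnion₂.1 (hKKM J hJ hpJ)
  have hwi : 0 < w i := by simpa [J] using hiJ
  have hle : w i * ∑ j, D j w ≤ D i w := hwA i hwi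
  have hDi : D i w = 0 := Metric.infDist_zero_of_mem hi
  rw [hDi] at hle
  have hsum : ∑ j, D j w = 0 :=
    le_antisymm (nonpos_of_mul_nonpos_right hle hwi) (Finset.sum_nonneg fun j _ => hD0 j w)
  refine ⟨p w, Set.mem_iInter.2 fun j => ((hFc j).mem_iff_infDist_zero (hne j)).2 ?_⟩
  exact (Finset.sum_eq_zero_iff_of_nonneg fun j _ => hD0 j w).1 hsum j (Finset.mem_univ j)
end

section
/- Sperner's lemma: Let δ ⊆ ℝ^d be a geometric n-simplex with vertices v_0, …, v_n, for i ∈ I = {0, …, n} let δ_i be the (n−1)-face of δ opposite to v_i, and let T be a triangulation of δ, i.e. a subdivision of the complex Δ consisting of δ and all its faces. Let φ be a Sperner coloring of T: a map from the vertex set of T to I such that φ(v) ≠ i whenever a vertex v of T lies in δ_i. Then the number of n-simplices σ of T whose vertex set is mapped by φ onto all of I is odd. -/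
open scoped Classical
open Finset

/-- A finite geometric simplicial complex in a real vector space `E`: a finite
collection of vertex sets of geometric simplices (finite affinely independent sets),
closed under passing to nonempty subsets (faces), such that the intersection of any two
of its geometric simplices (convex hulls of the vertex sets) is a face of each. -/
structure GeomComplex (E : Type*) [AddCommGroup E] [Module ℝ E] where
  faces : Finset (Finset E)
  nonempty_of_mem : ∀ σ ∈ faces, σ.Nonempty
  indep : ∀ σ ∈ faces, AffineIndependent ℝ ((↑) : σ → E)
  down_closed : ∀ σ ∈ faces, ∀ τ ⊆ σ, τ.Nonempty → τ ∈ faces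
  inter_face : ∀ σ ∈ faces, ∀ τ ∈ faces,
    convexHull ℝ (σ : Set E) ∩ convexHull ℝ (τ : Set E) =
      convexHull ℝ ((σ ∩ τ : Finset E) : Set E)

variable {E : Type*} [AddCommGroup E] [Module ℝ E]

/-- `T` is a subdivision of the complex whose faces are the members of the finite
collection `F` of vertex sets: every simplex of `T` is contained in a simplex of `F`
and every simplex of `F` is the union of the simplices of `T` contained in it. -/
def IsSubdivisionOfFaces (T : GeomComplex E) (F : Finset (Finset E)) : Prop :=
  (∀ σ' ∈ T.faces, ∃ σ ∈ F,
      convexHull ℝ (σ' : Set E) ⊆ convexHull ℝ (σ : Set E)) ∧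
  ∀ σ ∈ F, convexHull ℝ (σ : Set E) =
    ⋃ σ' ∈ T.faces.filter (fun τ =>
        convexHull ℝ (τ : Set E) ⊆ convexHull ℝ (σ : Set E)),
      convexHull ℝ (σ' : Set E)

section Weights

theorem AffineIndependent.weights_eq_of_finset {σ : Finset E}
    (h : AffineIndependent ℝ ((↑) : σ → E)) {c d : E → ℝ}
    (hs : ∑ x ∈ σ, c x = ∑ x ∈ σ, d x) (hv : ∑ x ∈ σ, c x • x = ∑ x ∈ σ, d x • x) :
    ∀ x ∈ σ, c x = d x := by
  intro x hx
  have := affineIndependent_iff.1 h Finset.univ (fun x => c x - d x)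
    (by
      rw [Finset.univ_eq_attach, Finset.sum_attach σ (fun x => c x - d x)]
      simp [hs])
    (by
      rw [Finset.univ_eq_attach, Finset.sum_attach σ (fun x => (c x - d x) • x)]
      simp [sub_smul, hv])
    ⟨x, hx⟩ (Finset.mem_univ _)
  exact sub_eq_zero.1 this

theorem exists_weights_of_mem_affineSpan_finset {σ : Finset E} {q : E}
    (hq : q ∈ affineSpan ℝ (σ : Set E)) :
    ∃ c : E → ℝ, ∑ x ∈ σ, c x = 1 ∧ ∑ x ∈ σ, c x • x = q := by
  have hq' : q ∈ affineSpan ℝ (Set.range ((↑) : σ → E)) := by simpa using hq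
  obtain ⟨w, hw, rfl⟩ := eq_affineCombination_of_mem_affineSpan_of_fintype hq'
  refine ⟨fun x => if hx : x ∈ σ then w ⟨x, hx⟩ else 0, ?_, ?_⟩
  · rw [← Finset.sum_attach, ← hw]
    exact Finset.sum_congr rfl fun x _ => by simp
  · rw [← Finset.sum_attach, Finset.affineCombination_eq_linear_combination _ _ _ hw]
    exact Finset.sum_congr rfl fun x _ => by simp

theorem LinearMap.eq_of_mem_affineSpan {s : Set E} (g : E →ₗ[ℝ] ℝ) {c : ℝ}
    (h : ∀ x ∈ s, g x = c) {q : E} (hq : q ∈ affineSpan ℝ s) : g q = c := by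
  refine affineSpan_induction (p := fun q => g q = c) hq h fun a u w z hu hw hz => ?_
  simp [hu, hw, hz]

theorem LinearMap.le_of_mem_convexHull {s : Set E} (g : E →ₗ[ℝ] ℝ) {c : ℝ}
    (h : ∀ x ∈ s, g x ≤ c) {q : E} (hq : q ∈ convexHull ℝ s) : g q ≤ c :=
  convexHull_min (t := {x | g x ≤ c}) h (convex_halfSpace_le g.isLinear c) hq

theorem AffineIndependent.affineSpan_eq_of_card_eq {σ ρ : Finset E}
    (hσ : AffineIndependent ℝ ((↑) : σ → E)) (hρ : AffineIndependent ℝ ((↑) : ρ → E))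
    (hle : (σ : Set E) ⊆ affineSpan ℝ (ρ : Set E)) (hcard : σ.card = ρ.card)
    (hne : ρ.Nonempty) : affineSpan ℝ (σ : Set E) = affineSpan ℝ (ρ : Set E) := by
  have hfin : FiniteDimensional ℝ (affineSpan ℝ (ρ : Set E)).direction := by
    rw [direction_affineSpan]
    exact finiteDimensional_vectorSpan_of_finite ℝ ρ.finite_toSet
  have hρ' := hρ.finrank_vectorSpan (n := ρ.card - 1)
    (by have := hne.card_pos; simp; omega)
  rw [show Set.range ((↑) : ρ → E) = (ρ : Set E) by ext; simp] at hρ'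
  have := hσ.affineSpan_eq_of_le_of_card_eq_finrank_add_one
    (sp := affineSpan ℝ (ρ : Set E)) (by simpa [affineSpan_le] using hle) (by
      rw [direction_affineSpan]
      have := hne.card_pos
      simp [hρ']; omega)
  simpa using this

theorem AffineIndependent.finset_image {ι : Type*} {v : ι → E} (hv : AffineIndependent ℝ v)
    (S : Finset ι) : AffineIndependent ℝ ((↑) : {x // x ∈ S.image v} → E) :=
  hv.range.mono (s := ((S.image v : Finset E) : Set E)) (by simp)

theorem mem_convexHull_image_finset {ι : Type*} {v : ι → E} (hv : Function.Injective v)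
    {S : Finset ι} {x : E} : x ∈ convexHull ℝ (v '' (S : Set ι)) ↔
      ∃ b : ι → ℝ, (∀ i ∈ S, 0 ≤ b i) ∧ ∑ i ∈ S, b i = 1 ∧ ∑ i ∈ S, b i • v i = x := by
  rw [← Finset.coe_image, Finset.mem_convexHull']
  constructor
  · rintro ⟨w, h0, h1, h2⟩
    rw [Finset.sum_image hv.injOn] at h1 h2
    exact ⟨fun i => w (v i), fun i hi => h0 _ (Finset.mem_image_of_mem v hi), h1, h2⟩
  · rintro ⟨b, h0, h1, rfl⟩
    rw [← Finset.mem_convexHull', Finset.coe_image]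
    exact (convex_convexHull ℝ _).sum_mem h0 h1 fun i hi =>
      subset_convexHull ℝ _ ⟨i, Finset.mem_coe.2 hi, rfl⟩

end Weights

namespace GeomComplex

theorem subset_of_weights_pos (T : GeomComplex E) {σ ρ : Finset E} (hσ : σ ∈ T.faces)
    (hρ : ρ ∈ T.faces) {c : E → ℝ} (hc : ∀ x ∈ σ, 0 < c x) (h1 : ∑ x ∈ σ, c x = 1)
    (hmem : ∑ x ∈ σ, c x • x ∈ convexHull ℝ (ρ : Set E)) : σ ⊆ ρ := by
  have hmem' : ∑ x ∈ σ, c x • x ∈ convexHull ℝ ((σ ∩ ρ : Finset E) : Set E) := by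
    rw [← T.inter_face σ hσ ρ hρ]
    exact ⟨Finset.mem_convexHull'.2 ⟨c, fun x hx => (hc x hx).le, h1, rfl⟩, hmem⟩
  obtain ⟨w, -, hw1, hw2⟩ := Finset.mem_convexHull'.1 hmem'
  rw [← Finset.filter_mem_eq_inter, Finset.sum_filter] at hw1 hw2
  intro x hx
  by_contra hxρ
  have := (T.indep σ hσ).weights_eq_of_finset (c := c)
    (d := fun y => if y ∈ ρ then w y else 0) (by rw [h1, hw1])
    (by rw [← hw2]; exact Finset.sum_congr rfl fun y _ => by simp [ite_smul]) x hx
  have h0 := hc x hx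
  simp [hxρ] at this
  linarith

/-- If two simplices of `T` share the facet `τ` and their apexes lie on the same side of it
within the span of one of them, then the simplices agree. -/
theorem apex_eq_of_same_side (T : GeomComplex E) {τ : Finset E} {w w' : E}
    (hτ : τ.Nonempty) (hw : w ∉ τ) (hw' : w' ∉ τ)
    (hσ : insert w τ ∈ T.faces) (hσ' : insert w' τ ∈ T.faces)
    (hspan : w' ∈ affineSpan ℝ ((insert w τ : Finset E) : Set E))
    (g : E →ₗ[ℝ] ℝ) {c : ℝ} (hg : ∀ x ∈ τ, g x = c)
    (hside : 0 < (g w - c) * (g w' - c)) : w = w' := by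
  obtain ⟨a, ha1, ha2⟩ := exists_weights_of_mem_affineSpan_finset hspan
  have haw : 0 < a w := by
    have h1 : g w' - c = a w * (g w - c) := by
      have hg' := congrArg g ha2
      rw [map_sum, Finset.sum_insert hw] at hg'
      rw [Finset.sum_insert hw] at ha1
      have : ∑ x ∈ τ, g (a x • x) = (∑ x ∈ τ, a x) * c := by
        rw [Finset.sum_mul]
        exact Finset.sum_congr rfl fun x hx => by simp [hg x hx]
      rw [this] at hg'
      simp only [map_smul, smul_eq_mul] at hg'
      linear_combination -hg' + c * ha1
    rw [h1] at hside
    by_contra hneg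
    nlinarith [sq_nonneg (g w - c), mul_nonneg (neg_nonneg.2 (not_lt.1 hneg)) (sq_nonneg (g w - c))]
  have hk : (0 : ℝ) < τ.card := by exact_mod_cast hτ.card_pos
  -- a point slightly off the centroid of `τ`, in the direction of `w'`
  obtain ⟨ε, hε0, hε1, hε⟩ : ∃ ε : ℝ, 0 < ε ∧ ε < 1 ∧
      ∀ x ∈ τ, 0 < (1 - ε) * (1 / τ.card : ℝ) + ε * a x := by
    have key : ∀ᶠ ε in nhdsWithin (0 : ℝ) (Set.Ioi 0),
        ∀ x ∈ τ, 0 < (1 - ε) * (1 / τ.card : ℝ) + ε * a x := by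
      rw [Filter.eventually_all_finset]
      intro x _
      have hcont : ContinuousAt (fun ε : ℝ => (1 - ε) * (1 / τ.card : ℝ) + ε * a x) 0 := by
        fun_prop
      exact (hcont.eventually (lt_mem_nhds (by simpa using hk))).filter_mono nhdsWithin_le_nhds
    have h01 : ∀ᶠ ε in nhdsWithin (0 : ℝ) (Set.Ioi 0), ε ∈ Set.Ioo (0 : ℝ) 1 :=
      Ioo_mem_nhdsGT one_pos
    obtain ⟨ε, h, h'⟩ := (key.and h01).exists
    exact ⟨ε, h'.1, h'.2, h⟩
  have hsub : insert w τ ⊆ insert w' τ := by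
    have hcent : ∑ x ∈ τ, (1 / τ.card : ℝ) = 1 := by
      rw [Finset.sum_const, nsmul_eq_mul]; field_simp
    refine T.subset_of_weights_pos hσ hσ'
      (c := fun x => (1 - ε) * (if x ∈ τ then (1 / τ.card : ℝ) else 0) + ε * a x) ?_ ?_ ?_
    · intro x hx
      rcases Finset.mem_insert.1 hx with rfl | hx
      · simp [hw]; positivity
      · simpa [hx] using hε x hx
    · rw [Finset.sum_add_distrib, ← Finset.mul_sum, ← Finset.mul_sum, ha1,
        Finset.sum_insert hw, if_neg hw, Finset.sum_congr rfl fun x hx => if_pos hx, hcent]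
      ring
    · simp only [add_smul, mul_smul]
      rw [Finset.sum_add_distrib, ← Finset.smul_sum, ← Finset.smul_sum, ha2,
        Finset.sum_insert hw, if_neg hw, zero_smul, zero_add]
      refine convex_convexHull ℝ ((insert w' τ : Finset E) : Set E) ?_
        (subset_convexHull ℝ _ (by simp)) (by linarith) hε0.le (by ring)
      refine Finset.mem_convexHull'.2
        ⟨fun x => if x ∈ τ then (1 / τ.card : ℝ) else 0, fun x _ => ?_, ?_, ?_⟩
      · dsimp only; split_ifs <;> positivity
      · rw [Finset.sum_insert hw', if_neg hw', Finset.sum_congr rfl fun x hx => if_pos hx,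
          hcent, zero_add]
      · simp only [Finset.sum_insert hw', if_neg hw', zero_smul, zero_add]
  have := hsub (Finset.mem_insert_self w τ)
  simpa [hw] using this

end GeomComplex

namespace GeomComplex

/-- The vertices `w` outside `τ` such that `insert w τ` is a simplex of `T` contained in `K`. -/
noncomputable def apexes (T : GeomComplex E) (K : Set E) (τ : Finset E) : Finset E :=
  (T.faces.biUnion id).filter fun w =>
    w ∉ τ ∧ insert w τ ∈ T.faces ∧ convexHull ℝ ((insert w τ : Finset E) : Set E) ⊆ K

theorem mem_apexes {T : GeomComplex E} {K : Set E} {τ : Finset E} {w : E} :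
    w ∈ T.apexes K τ ↔ w ∉ τ ∧ insert w τ ∈ T.faces ∧
      convexHull ℝ ((insert w τ : Finset E) : Set E) ⊆ K := by
  simp only [apexes, Finset.mem_filter, Finset.mem_biUnion, id, and_iff_right_iff_imp]
  exact fun h => ⟨_, h.2.1, Finset.mem_insert_self _ _⟩

theorem card_filter_subset_eq_card_apexes (T : GeomComplex E) (K : Set E) (τ : Finset E) :
    ((T.faces.filter fun σ : Finset E => convexHull ℝ (σ : Set E) ⊆ K ∧ σ.card = τ.card + 1).filter
      fun σ : Finset E => τ ⊆ σ).card = (T.apexes K τ).card := by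
  symm
  refine Finset.card_bij (fun w _ => insert w τ) ?_ ?_ ?_
  · intro w hw
    obtain ⟨h1, h2, h3⟩ := mem_apexes.1 hw
    simp only [Finset.mem_filter]
    exact ⟨⟨h2, h3, Finset.card_insert_of_notMem h1⟩, Finset.subset_insert _ _⟩
  · intro w hw w' hw' h
    have := h ▸ Finset.mem_insert_self w τ
    simpa [(mem_apexes.1 hw).1] using this
  · intro σ hσ
    simp only [Finset.mem_filter] at hσ
    obtain ⟨⟨h1, h2, h3⟩, h4⟩ := hσ
    have h5 : (σ \ τ).card = 1 := by
      rw [Finset.card_sdiff_of_subset h4, h3]; omega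
    obtain ⟨w, hw⟩ := Finset.card_eq_one.1 h5
    have hins : insert w τ = σ := by
      rw [Finset.insert_eq, ← hw, Finset.sdiff_union_of_subset h4]
    have hwτ : w ∉ τ := (Finset.mem_sdiff.1 (hw ▸ Finset.mem_singleton_self w)).2
    exact ⟨w, mem_apexes.2 ⟨hwτ, hins ▸ h1, hins ▸ h2⟩, hins⟩

theorem exists_mem_apexes [TopologicalSpace E] [IsTopologicalAddGroup E] [ContinuousSMul ℝ E]
    [T2Space E] (T : GeomComplex E) {K : Set E} (hK : Convex ℝ K)
    (hcov : ∀ x ∈ K, ∃ ρ ∈ T.faces, convexHull ℝ (ρ : Set E) ⊆ K ∧ x ∈ convexHull ℝ (ρ : Set E))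
    {τ : Finset E} (hτ : τ ∈ T.faces) (hτK : (τ : Set E) ⊆ K) (g : E →ₗ[ℝ] ℝ) {c : ℝ}
    (hg : ∀ x ∈ τ, g x = c) {q : E} (hq : q ∈ K) (hqc : g q ≠ c) :
    ∃ w ∈ T.apexes K τ, 0 < (g w - c) * (g q - c) := by
  have hk : (0 : ℝ) < τ.card := by exact_mod_cast (T.nonempty_of_mem τ hτ).card_pos
  have hcent : ∑ x ∈ τ, (1 / τ.card : ℝ) = 1 := by
    rw [Finset.sum_const, nsmul_eq_mul]; field_simp
  set p : E := ∑ x ∈ τ, (1 / τ.card : ℝ) • x with hp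
  have hpτ : p ∈ convexHull ℝ (τ : Set E) :=
    Finset.mem_convexHull'.2 ⟨fun _ => 1 / τ.card, fun _ _ => by positivity, hcent, rfl⟩
  have hpK : p ∈ K := convexHull_min hτK hK hpτ
  have hgp : g p = c := g.eq_of_mem_affineSpan hg (convexHull_subset_affineSpan _ hpτ)
  let z : ℕ → E := fun m => AffineMap.lineMap p q (1 / ((m : ℝ) + 1))
  have hz : Filter.Tendsto z Filter.atTop (nhds p) := by
    have h1 : Continuous fun t : ℝ => (AffineMap.lineMap p q t : E) := by
      simp only [AffineMap.lineMap_apply_module]; fun_prop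
    have h2 := (h1.tendsto 0).comp tendsto_one_div_add_atTop_nhds_zero_nat
    simpa [Function.comp_def, z] using h2
  have hzK : ∀ m, z m ∈ K := fun m =>
    hK.lineMap_mem hpK hq ⟨by positivity, by rw [div_le_one (by positivity)]; simp⟩
  obtain ⟨ρ, hρ, hρK, hfreq⟩ : ∃ ρ ∈ T.faces, convexHull ℝ (ρ : Set E) ⊆ K ∧
      ∃ᶠ m in Filter.atTop, z m ∈ convexHull ℝ (ρ : Set E) := by
    by_contra! hcon
    have : ∀ᶠ m in Filter.atTop,
        ∀ ρ ∈ T.faces.filter fun ρ : Finset E => convexHull ℝ (ρ : Set E) ⊆ K,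
        z m ∉ convexHull ℝ (ρ : Set E) := by
      rw [Filter.eventually_all_finset]
      intro ρ hρ
      rw [Finset.mem_filter] at hρ
      exact hcon ρ hρ.1 hρ.2
    obtain ⟨m, hm⟩ := this.exists
    obtain ⟨ρ, h1, h2, h3⟩ := hcov _ (hzK m)
    exact hm ρ (Finset.mem_filter.2 ⟨h1, h2⟩) h3
  have hpρ : p ∈ convexHull ℝ (ρ : Set E) :=
    (ρ.finite_toSet.isClosed_convexHull ℝ).mem_of_frequently_of_tendsto hfreq hz
  have hτρ : τ ⊆ ρ :=
    T.subset_of_weights_pos hτ hρ (c := fun _ => 1 / τ.card) (fun _ _ => by positivity) hcent hpρ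
  obtain ⟨m, hm⟩ := hfreq.exists
  obtain ⟨w, hwρ, hw⟩ : ∃ w ∈ ρ, 0 < (g w - c) * (g q - c) := by
    by_contra! hcon
    have h1 := ((g q - c) • g).le_of_mem_convexHull (c := (g q - c) * c)
      (fun x hx => by
        have := hcon x hx
        simp only [LinearMap.smul_apply, smul_eq_mul]; linarith) hm
    have h2 : g (z m) - c = 1 / ((m : ℝ) + 1) * (g q - c) := by
      simp only [z, AffineMap.lineMap_apply_module, map_add, map_smul, hgp, smul_eq_mul]; ring
    have h3 : 0 < 1 / ((m : ℝ) + 1) * (g q - c) ^ 2 :=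
      mul_pos (by positivity) (by have := sub_ne_zero.2 hqc; positivity)
    simp only [LinearMap.smul_apply, smul_eq_mul] at h1
    have h4 : (g q - c) * (g (z m) - c) = 1 / ((m : ℝ) + 1) * (g q - c) ^ 2 := by rw [h2]; ring
    linarith
  have hwτ : w ∉ τ := fun h => by simp [hg w h] at hw
  have hsub : insert w τ ⊆ ρ := Finset.insert_subset hwρ hτρ
  exact ⟨w, mem_apexes.2 ⟨hwτ, T.down_closed ρ hρ _ hsub (Finset.insert_nonempty _ _),
    (convexHull_mono (Finset.coe_subset.2 hsub)).trans hρK⟩, hw⟩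

section Facets

variable {ι : Type*} {v : ι → E}

theorem affineSpan_eq_of_card_eq
    (hv : AffineIndependent ℝ v) (T : GeomComplex E)
    {R : Finset ι} {σ : Finset E} (hσ : σ ∈ T.faces)
    (hcardσ : σ.card = R.card)
    (hle : (σ : Set E) ⊆ convexHull ℝ (v '' (R : Set ι))) :
    affineSpan ℝ (σ : Set E) = affineSpan ℝ (v '' (R : Set ι)) := by
  have hcard' : σ.card = (R.image v).card := by
    rw [hcardσ, Finset.card_image_of_injective _ hv.injective]
  have := (T.indep σ hσ).affineSpan_eq_of_card_eq (hv.finset_image R)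
    (by simpa using hle.trans (convexHull_subset_affineSpan _)) hcard'
    (Finset.card_pos.1 (hcard' ▸ (T.nonempty_of_mem σ hσ).card_pos))
  simpa using this

theorem exists_linearMap_of_facet
    (hv : AffineIndependent ℝ v) (T : GeomComplex E) {S : Finset ι} {a : ι} (ha : a ∉ S)
    {τ : Finset E} (hτ : τ ∈ T.faces) (hcard : τ.card = S.card) :
    ∃ (g : E →ₗ[ℝ] ℝ) (c : ℝ), (∀ x ∈ τ, g x = c) ∧ (∃ i ∈ insert a S, g (v i) ≠ c) ∧
      ∀ w ∈ T.apexes (convexHull ℝ (v '' (insert a S : Finset ι))) τ, g w ≠ c := by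
  obtain ⟨i, hi, hvi⟩ : ∃ i ∈ insert a S, v i ∉ affineSpan ℝ (τ : Set E) := by
    by_contra! hcon
    have h1 := (hv.finset_image S).affineSpan_eq_of_card_eq (T.indep τ hτ)
      (by
        rintro _ hx
        obtain ⟨i, hi, rfl⟩ := Finset.mem_image.1 (Finset.mem_coe.1 hx)
        exact hcon i (Finset.mem_insert_of_mem hi))
      (by rw [hcard, Finset.card_image_of_injective _ hv.injective]) (T.nonempty_of_mem τ hτ)
    have h2 := hcon a (Finset.mem_insert_self _ _)
    rw [← h1, Finset.coe_image, hv.mem_affineSpan_iff] at h2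
    exact ha h2
  obtain ⟨x₀, hx₀⟩ := T.nonempty_of_mem τ hτ
  have hvx : v i - x₀ ∉ vectorSpan ℝ (τ : Set E) := fun h => hvi <| by
    have := vadd_mem_affineSpan_of_mem_affineSpan_of_mem_vectorSpan
      (mem_affineSpan ℝ (Finset.mem_coe.2 hx₀)) h
    simpa using this
  obtain ⟨g, hg, hker⟩ := Submodule.exists_le_ker_of_notMem hvx
  have hgτ : ∀ x ∈ τ, g x = g x₀ := fun x hx => by
    have := hker (vsub_mem_vectorSpan ℝ (Finset.mem_coe.2 hx) (Finset.mem_coe.2 hx₀))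
    rwa [LinearMap.mem_ker, vsub_eq_sub, map_sub, sub_eq_zero] at this
  have hgi : g (v i) ≠ g x₀ := fun h => hg (by rw [map_sub, h, sub_self])
  refine ⟨g, g x₀, hgτ, ⟨i, hi, hgi⟩, fun w hw hgw => hgi ?_⟩
  obtain ⟨h1, h2, h3⟩ := mem_apexes.1 hw
  refine g.eq_of_mem_affineSpan (s := ((insert w τ : Finset E) : Set E)) ?_ ?_
  · intro x hx
    rcases Finset.mem_insert.1 (Finset.mem_coe.1 hx) with rfl | hx
    exacts [hgw, hgτ x hx]
  · rw [T.affineSpan_eq_of_card_eq hv h2 (R := insert a S)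
      (by rw [Finset.card_insert_of_notMem h1, Finset.card_insert_of_notMem ha, hcard])
      ((subset_convexHull ℝ _).trans h3)]
    exact mem_affineSpan ℝ ⟨i, Finset.mem_coe.2 hi, rfl⟩

theorem apex_eq_of_mem_apexes
    (hv : AffineIndependent ℝ v) (T : GeomComplex E) {S : Finset ι} {a : ι} (ha : a ∉ S)
    {τ : Finset E} (hτ : τ ∈ T.faces) (hcard : τ.card = S.card)
    (g : E →ₗ[ℝ] ℝ) {c : ℝ} (hg : ∀ x ∈ τ, g x = c) {w w' : E}
    (hw : w ∈ T.apexes (convexHull ℝ (v '' (insert a S : Finset ι))) τ)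
    (hw' : w' ∈ T.apexes (convexHull ℝ (v '' (insert a S : Finset ι))) τ)
    (hside : 0 < (g w - c) * (g w' - c)) : w = w' := by
  obtain ⟨h1, h2, h3⟩ := mem_apexes.1 hw
  obtain ⟨h1', h2', h3'⟩ := mem_apexes.1 hw'
  refine T.apex_eq_of_same_side (T.nonempty_of_mem τ hτ) h1 h1' h2 h2' ?_ g hg hside
  rw [T.affineSpan_eq_of_card_eq hv h2 (R := insert a S)
      (by rw [Finset.card_insert_of_notMem h1, Finset.card_insert_of_notMem ha, hcard])
      ((subset_convexHull ℝ _).trans h3)]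
  exact convexHull_subset_affineSpan _ (h3' (subset_convexHull ℝ _ (by simp)))

variable [TopologicalSpace E] [IsTopologicalAddGroup E] [ContinuousSMul ℝ E] [T2Space E]

theorem card_apexes_of_boundary
    (hv : AffineIndependent ℝ v) (T : GeomComplex E) {S : Finset ι} {a : ι} (ha : a ∉ S)
    {τ : Finset E} (hτ : τ ∈ T.faces) (hcard : τ.card = S.card)
    (hcov : ∀ x ∈ convexHull ℝ (v '' (insert a S : Finset ι)), ∃ ρ ∈ T.faces,
      convexHull ℝ (ρ : Set E) ⊆ convexHull ℝ (v '' (insert a S : Finset ι)) ∧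
        x ∈ convexHull ℝ (ρ : Set E))
    (hτS : convexHull ℝ (τ : Set E) ⊆ convexHull ℝ (v '' (S : Set ι))) :
    (T.apexes (convexHull ℝ (v '' (insert a S : Finset ι))) τ).card = 1 := by
  obtain ⟨g, c, hg, ⟨i, hi, hgi⟩, hne⟩ := T.exists_linearMap_of_facet hv ha hτ hcard
  have hτS' : (τ : Set E) ⊆ convexHull ℝ (v '' (S : Set ι)) := (subset_convexHull ℝ _).trans hτS
  have hgS : ∀ j ∈ S, g (v j) = c := fun j hj => by
    refine g.eq_of_mem_affineSpan (s := (τ : Set E)) hg ?_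
    rw [T.affineSpan_eq_of_card_eq hv hτ hcard hτS']
    exact mem_affineSpan ℝ ⟨j, Finset.mem_coe.2 hj, rfl⟩
  obtain rfl : i = a := (Finset.mem_insert.1 hi).resolve_right fun h => hgi (hgS i h)
  have hτK : (τ : Set E) ⊆ convexHull ℝ (v '' (insert i S : Finset ι)) :=
    hτS'.trans (convexHull_mono (Set.image_mono (by simp)))
  obtain ⟨w, hw, hside⟩ := T.exists_mem_apexes (convex_convexHull ℝ _) hcov hτ hτK g hg
    (subset_convexHull ℝ _ ⟨i, Finset.mem_coe.2 hi, rfl⟩) hgi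
  refine Finset.card_eq_one.2 ⟨w, Finset.eq_singleton_iff_unique_mem.2 ⟨hw, fun w' hw' => ?_⟩⟩
  refine T.apex_eq_of_mem_apexes hv ha hτ hcard g hg hw' hw ?_
  have hge := ((c - g (v i)) • g).le_of_mem_convexHull (c := (c - g (v i)) * c) (q := w')
    (by
      rintro _ ⟨j, hj, rfl⟩
      simp only [LinearMap.smul_apply, smul_eq_mul]
      rcases Finset.mem_insert.1 (Finset.mem_coe.1 hj) with rfl | hj
      · nlinarith [sq_nonneg (c - g (v j))]
      · rw [hgS j hj])
    ((mem_apexes.1 hw').2.2 (subset_convexHull ℝ _ (by simp)))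
  simp only [LinearMap.smul_apply, smul_eq_mul] at hge
  have hpos : 0 < (g w' - c) * (g (v i) - c) :=
    lt_of_le_of_ne (by linarith)
      (mul_ne_zero (sub_ne_zero.2 (hne w' hw')) (sub_ne_zero.2 hgi)).symm
  by_contra hcon
  nlinarith [mul_pos hpos hside, mul_nonneg (neg_nonneg.2 (not_lt.1 hcon))
    (sq_nonneg (g (v i) - c))]

theorem card_apexes_of_interior
    (hv : AffineIndependent ℝ v) (T : GeomComplex E) {S : Finset ι} {a : ι} (ha : a ∉ S)
    {τ : Finset E} (hτ : τ ∈ T.faces) (hcard : τ.card = S.card)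
    (hcov : ∀ x ∈ convexHull ℝ (v '' (insert a S : Finset ι)), ∃ ρ ∈ T.faces,
      convexHull ℝ (ρ : Set E) ⊆ convexHull ℝ (v '' (insert a S : Finset ι)) ∧
        x ∈ convexHull ℝ (ρ : Set E))
    (hτK : convexHull ℝ (τ : Set E) ⊆ convexHull ℝ (v '' (insert a S : Finset ι)))
    (hint : ∀ i ∈ insert a S, ∃ x ∈ τ,
      x ∉ convexHull ℝ (v '' ((insert a S).erase i : Finset ι))) :
    (T.apexes (convexHull ℝ (v '' (insert a S : Finset ι))) τ).card = 2 := by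
  obtain ⟨g, c, hg, ⟨i, hi, hgi⟩, hne⟩ := T.exists_linearMap_of_facet hv ha hτ hcard
  have hτK' := (subset_convexHull ℝ _).trans hτK
  obtain ⟨j, hj, hgj⟩ : ∃ j ∈ insert a S, (g (v j) - c) * (g (v i) - c) < 0 := by
    by_contra! hcon
    choose! b hb0 hb1 hb2 using fun x (hx : x ∈ τ) =>
      (mem_convexHull_image_finset hv.injective).1 (hτK' (Finset.mem_coe.2 hx))
    have hzero : ∀ x ∈ τ, ∀ j ∈ insert a S, b x j * ((g (v j) - c) * (g (v i) - c)) = 0 := by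
      intro x hx
      refine (Finset.sum_eq_zero_iff_of_nonneg fun j hj =>
        mul_nonneg (hb0 x hx j hj) (hcon j hj)).1 ?_
      have h1 := hg x hx
      rw [← hb2 x hx, map_sum] at h1
      simp only [map_smul, smul_eq_mul] at h1
      have h2 : ∀ j ∈ insert a S, b x j * ((g (v j) - c) * (g (v i) - c)) =
          (b x j * g (v j)) * (g (v i) - c) - b x j * (c * (g (v i) - c)) := fun j _ => by ring
      rw [Finset.sum_congr rfl h2, Finset.sum_sub_distrib, ← Finset.sum_mul, ← Finset.sum_mul,
        h1, hb1 x hx]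
      ring
    obtain ⟨x, hx, hxi⟩ := hint i hi
    have hbi : b x i = 0 := by
      have := hzero x hx i hi
      simpa [sub_ne_zero.2 hgi] using this
    refine hxi ((mem_convexHull_image_finset hv.injective).2
      ⟨b x, fun j hj => hb0 x hx j (Finset.mem_of_mem_erase hj), ?_, ?_⟩)
    · rw [Finset.sum_erase _ hbi, hb1 x hx]
    · rw [Finset.sum_erase _ (by simp [hbi]), hb2 x hx]
  have hgj' : g (v j) ≠ c := fun h => by simp [h] at hgj
  obtain ⟨w, hw, hside⟩ := T.exists_mem_apexes (convex_convexHull ℝ _) hcov hτ hτK' g hg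
    (subset_convexHull ℝ _ ⟨i, Finset.mem_coe.2 hi, rfl⟩) hgi
  obtain ⟨w', hw', hside'⟩ := T.exists_mem_apexes (convex_convexHull ℝ _) hcov hτ hτK' g hg
    (subset_convexHull ℝ _ ⟨j, Finset.mem_coe.2 hj, rfl⟩) hgj'
  have hopp : (g w - c) * (g w' - c) < 0 := by
    have h1 := mul_pos hside hside'
    by_contra hcon
    nlinarith [mul_nonneg (not_lt.1 hcon) (neg_nonneg.2 hgj.le)]
  refine Finset.card_eq_two.2 ⟨w, w', ?_, ?_⟩
  · rintro rfl
    exact absurd hopp (not_lt.2 (mul_self_nonneg _))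
  ext u
  simp only [Finset.mem_insert, Finset.mem_singleton]
  constructor
  · intro hu
    rcases lt_or_gt_of_ne (mul_ne_zero (sub_ne_zero.2 (hne u hu)) (sub_ne_zero.2 (hne w hw)))
      with h | h
    · refine Or.inr (T.apex_eq_of_mem_apexes hv ha hτ hcard g hg hu hw' ?_)
      have h1 := mul_pos_of_neg_of_neg h hopp
      by_contra hcon
      nlinarith [mul_nonneg (neg_nonneg.2 (not_lt.1 hcon)) (sq_nonneg (g w - c))]
    · exact Or.inl (T.apex_eq_of_mem_apexes hv ha hτ hcard g hg hu hw h)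
  · rintro (rfl | rfl) <;> assumption

end Facets

end GeomComplex

section Coloring

variable {α ι : Type*}

theorem Finset.card_filter_subset_eq_card_filter_erase (φ : α → ι) {σ : Finset α}
    {R : Finset ι} (hcard : σ.card = R.card + 1) {s : Finset (Finset α)}
    (hs : ∀ τ ⊆ σ, τ ∈ s ↔ τ.card = R.card ∧ τ.image φ = R) :
    (s.filter fun τ : Finset α => τ ⊆ σ).card =
      (σ.filter fun x => (σ.erase x).image φ = R).card := by
  symm
  refine Finset.card_bij (fun x _ => σ.erase x) ?_ ?_ ?_
  · intro x hx
    obtain ⟨h1, h2⟩ := Finset.mem_filter.1 hx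
    refine Finset.mem_filter.2 ⟨(hs _ (Finset.erase_subset _ _)).2 ⟨?_, h2⟩,
      Finset.erase_subset _ _⟩
    rw [Finset.card_erase_of_mem h1, hcard, Nat.add_sub_cancel]
  · intro x hx y hy h
    exact Finset.erase_injOn σ (Finset.mem_filter.1 hx).1 (Finset.mem_filter.1 hy).1 h
  · intro τ hτ
    obtain ⟨h1, h2⟩ := Finset.mem_filter.1 hτ
    obtain ⟨h3, h4⟩ := (hs τ h2).1 h1
    have h5 : (σ \ τ).card = 1 := by
      rw [Finset.card_sdiff_of_subset h2, hcard, h3]; omega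
    obtain ⟨x, hx⟩ := Finset.card_eq_one.1 h5
    have hxσ : x ∈ σ := (Finset.mem_sdiff.1 (hx ▸ Finset.mem_singleton_self x)).1
    have he : σ.erase x = τ := by
      rw [Finset.erase_eq, ← hx, Finset.sdiff_sdiff_eq_self h2]
    exact ⟨x, Finset.mem_filter.2 ⟨hxσ, by rw [he, h4]⟩, he⟩

/-- A set with one more element than there are colors in `R`, colored by `R` and one extra color
`a`, has an odd number of facets colored exactly by `R` iff it uses all the colors. -/
theorem Finset.odd_card_filter_erase_iff (φ : α → ι) {σ : Finset α} {R : Finset ι} {a : ι}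
    (ha : a ∉ R) (hcard : σ.card = R.card + 1) (himg : σ.image φ ⊆ insert a R) :
    Odd (σ.filter fun x => (σ.erase x).image φ = R).card ↔ σ.image φ = insert a R := by
  constructor
  · intro hodd
    by_contra hne
    obtain ⟨x, hx⟩ := Finset.card_pos.1 hodd.pos
    obtain ⟨hxσ, hxR⟩ := Finset.mem_filter.1 hx
    have hφx : φ x ∈ R := by
      refine (Finset.mem_insert.1 (himg (Finset.mem_image_of_mem φ hxσ))).resolve_left fun h => ?_
      apply hne
      rw [← Finset.insert_erase hxσ, Finset.image_insert, hxR, h]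
    have hinj : Set.InjOn φ (σ.erase x : Finset α) := by
      rw [← Finset.card_image_iff, hxR, Finset.card_erase_of_mem hxσ, hcard, Nat.add_sub_cancel]
    obtain ⟨y, hy, hyx⟩ := Finset.mem_image.1 (hxR.symm ▸ hφx)
    have hyσ := Finset.mem_of_mem_erase hy
    have hyne := Finset.ne_of_mem_erase hy
    have hpair : (σ.filter fun z => (σ.erase z).image φ = R) = {x, y} := by
      ext z
      simp only [Finset.mem_filter, Finset.mem_insert, Finset.mem_singleton]
      constructor
      · rintro ⟨hz, hzR⟩
        by_contra! hcon
        have hzx : z ∈ σ.erase x := Finset.mem_erase.2 ⟨hcon.1, hz⟩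
        obtain ⟨u, hu, huz⟩ := Finset.mem_image.1
          (hzR.symm ▸ hxR ▸ Finset.mem_image_of_mem φ hzx : φ z ∈ (σ.erase z).image φ)
        obtain ⟨huz', huσ⟩ := Finset.mem_erase.1 hu
        by_cases hux : u = x
        · subst hux
          exact hcon.2 (hinj hzx hy (by rw [hyx, huz]))
        · exact huz' (hinj (Finset.mem_coe.2 (Finset.mem_erase.2 ⟨hux, huσ⟩)) hzx huz)
      · rintro (rfl | rfl)
        · exact ⟨hxσ, hxR⟩
        · refine ⟨hyσ, ?_⟩
          rw [← hxR]
          ext r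
          simp only [Finset.mem_image, Finset.mem_erase]
          constructor
          · rintro ⟨u, ⟨hu1, hu2⟩, rfl⟩
            by_cases hux : u = x
            · exact ⟨z, ⟨hyne, hyσ⟩, by rw [hyx, hux]⟩
            · exact ⟨u, ⟨hux, hu2⟩, rfl⟩
          · rintro ⟨u, ⟨hu1, hu2⟩, rfl⟩
            by_cases huy : u = z
            · exact ⟨x, ⟨hyne.symm, hxσ⟩, by rw [← hyx, huy]⟩
            · exact ⟨u, ⟨huy, hu2⟩, rfl⟩
    rw [hpair, Finset.card_pair hyne.symm] at hodd
    exact absurd hodd (by decide)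
  · intro h
    have hinj : Set.InjOn φ σ := by
      rw [← Finset.card_image_iff, h, Finset.card_insert_of_notMem ha, hcard]
    obtain ⟨x, hx, hxa⟩ := Finset.mem_image.1 (h ▸ Finset.mem_insert_self a R)
    have : (σ.filter fun z => (σ.erase z).image φ = R) = {x} := by
      ext z
      simp only [Finset.mem_filter, Finset.mem_singleton]
      constructor
      · rintro ⟨hz, hzR⟩
        by_contra hne
        exact ha (hzR ▸ Finset.mem_image.2 ⟨x, Finset.mem_erase.2 ⟨Ne.symm hne, hx⟩, hxa⟩)
      · rintro rfl
        refine ⟨hx, ?_⟩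
        rw [Finset.erase_eq, Finset.image_sdiff_of_injOn hinj (by simpa using hx), h]
        simp [hxa, Finset.insert_sdiff_of_mem, ha]
    rw [this]
    simp

end Coloring

theorem GeomComplex.odd_card_rainbow [TopologicalSpace E] [IsTopologicalAddGroup E]
    [ContinuousSMul ℝ E] [T2Space E] {ι : Type*} {v : ι → E} (hv : AffineIndependent ℝ v)
    (T : GeomComplex E)
    (hcov : ∀ S : Finset ι, S.Nonempty → ∀ x ∈ convexHull ℝ (v '' (S : Set ι)), ∃ ρ ∈ T.faces,
      convexHull ℝ (ρ : Set E) ⊆ convexHull ℝ (v '' (S : Set ι)) ∧ x ∈ convexHull ℝ (ρ : Set E))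
    (φ : E → ι)
    (hφ : ∀ σ ∈ T.faces, ∀ w ∈ σ, ∀ S : Finset ι, w ∈ convexHull ℝ (v '' (S : Set ι)) → φ w ∈ S)
    {S : Finset ι} (hS : S.Nonempty) :
    Odd (T.faces.filter fun σ : Finset E => convexHull ℝ (σ : Set E) ⊆
      convexHull ℝ (v '' (S : Set ι)) ∧ σ.card = S.card ∧ σ.image φ = S).card := by
  have hmem : ∀ {σ : Finset E} {K : Set E}, convexHull ℝ (σ : Set E) ⊆ K → ∀ x ∈ σ, x ∈ K :=
    fun h x hx => h (subset_convexHull ℝ _ (Finset.mem_coe.2 hx))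
  induction hS using Finset.Nonempty.cons_induction with
  | singleton a =>
    have hsingle : ∀ σ ∈ T.faces, convexHull ℝ (σ : Set E) ⊆
        convexHull ℝ (v '' (({a} : Finset ι) : Set ι)) → σ = {v a} := fun σ hσ h =>
      (Finset.eq_singleton_iff_nonempty_unique_mem).2 ⟨T.nonempty_of_mem σ hσ, fun x hx => by
        simpa using hmem h x hx⟩
    obtain ⟨ρ, hρ, hρK, -⟩ := hcov {a} (Finset.singleton_nonempty a) (v a) (by simp)
    have hρ' := hsingle ρ hρ hρK
    subst hρ'
    have hcolor : φ (v a) = a := by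
      simpa using hφ _ hρ (v a) (by simp) {a} (by simp)
    have : (T.faces.filter fun σ : Finset E => convexHull ℝ (σ : Set E) ⊆
        convexHull ℝ (v '' (({a} : Finset ι) : Set ι)) ∧ σ.card = ({a} : Finset ι).card ∧
          σ.image φ = {a}) = {{v a}} := by
      ext σ
      rw [Finset.mem_filter, Finset.mem_singleton]
      constructor
      · exact fun h => hsingle σ h.1 h.2.1
      · rintro rfl
        exact ⟨hρ, hρK, by simp, by simp [hcolor]⟩
    rw [this]
    simp
  | cons a S ha hS ih =>
    rw [Finset.cons_eq_insert]
    set K := convexHull ℝ (v '' (insert a S : Finset ι)) with hK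
    have hSK : convexHull ℝ (v '' (S : Set ι)) ⊆ K :=
      convexHull_mono (Set.image_mono (by simp))
    set s := T.faces.filter fun τ : Finset E =>
      convexHull ℝ (τ : Set E) ⊆ K ∧ τ.card = S.card ∧ τ.image φ = S with hs
    set t := T.faces.filter fun σ : Finset E =>
      convexHull ℝ (σ : Set E) ⊆ K ∧ σ.card = S.card + 1 with ht
    have hcov' := hcov (insert a S) (Finset.insert_nonempty _ _)
    have hτ : ∀ τ ∈ s, (Odd (Finset.bipartiteAbove (fun τ σ : Finset E => τ ⊆ σ) t τ).card ↔
        convexHull ℝ (τ : Set E) ⊆ convexHull ℝ (v '' (S : Set ι))) := by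
      intro τ hτ
      obtain ⟨h1, h2, h3, h4⟩ := Finset.mem_filter.1 hτ
      rw [Finset.bipartiteAbove, ht, ← h3, T.card_filter_subset_eq_card_apexes]
      by_cases hb : convexHull ℝ (τ : Set E) ⊆ convexHull ℝ (v '' (S : Set ι))
      · rw [T.card_apexes_of_boundary hv ha h1 h3 hcov' hb]
        simpa using hb
      · rw [T.card_apexes_of_interior hv ha h1 h3 hcov' h2]
        · exact iff_of_false (by decide) hb
        intro i hi
        by_contra! hcon
        rcases Finset.mem_insert.1 hi with rfl | hi
        · rw [Finset.erase_insert ha] at hcon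
          exact hb (convexHull_min hcon (convex_convexHull ℝ _))
        · obtain ⟨x, hx, rfl⟩ := Finset.mem_image.1 (h4.symm ▸ hi)
          simpa using hφ τ h1 x hx _ (hcon x hx)
    have hσ : ∀ σ ∈ t, (Odd (Finset.bipartiteBelow (fun τ σ : Finset E => τ ⊆ σ) s σ).card ↔
        σ.image φ = insert a S) := by
      intro σ hσ
      obtain ⟨h1, h2, h3⟩ := Finset.mem_filter.1 hσ
      rw [Finset.bipartiteBelow, Finset.card_filter_subset_eq_card_filter_erase φ h3,
        Finset.odd_card_filter_erase_iff φ ha h3]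
      · exact Finset.image_subset_iff.2 fun x hx => hφ σ h1 x hx _ (hmem h2 x hx)
      · intro τ hτσ
        rw [hs, Finset.mem_filter]
        refine ⟨fun h => h.2.2, fun h => ⟨T.down_closed σ h1 τ hτσ ?_, ?_, h⟩⟩
        · exact Finset.card_pos.1 (h.1 ▸ hS.card_pos)
        · exact (convexHull_mono (Finset.coe_subset.2 hτσ)).trans h2
    have hcount := Finset.sum_card_bipartiteAbove_eq_sum_card_bipartiteBelow
      (fun τ σ : Finset E => τ ⊆ σ) (s := s) (t := t)
    have hodd := congrArg Odd hcount
    rw [Finset.odd_sum_iff_odd_card_odd, Finset.odd_sum_iff_odd_card_odd,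
      Finset.filter_congr hτ, Finset.filter_congr hσ] at hodd
    have hs' : (s.filter fun τ : Finset E =>
        convexHull ℝ (τ : Set E) ⊆ convexHull ℝ (v '' (S : Set ι))) =
        T.faces.filter fun τ : Finset E => convexHull ℝ (τ : Set E) ⊆
          convexHull ℝ (v '' (S : Set ι)) ∧ τ.card = S.card ∧ τ.image φ = S := by
      ext τ
      simp only [hs, Finset.mem_filter]
      exact ⟨fun h => ⟨h.1.1, h.2, h.1.2.2⟩, fun h => ⟨⟨h.1, h.2.1.trans hSK, h.2.2⟩, h.2.1⟩⟩
    have ht' : (t.filter fun σ : Finset E => σ.image φ = insert a S) =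
        T.faces.filter fun σ : Finset E => convexHull ℝ (σ : Set E) ⊆ K ∧
          σ.card = (insert a S).card ∧ σ.image φ = insert a S := by
      ext σ
      simp only [ht, Finset.mem_filter, Finset.card_insert_of_notMem ha, and_assoc]
    rw [hs', ht'] at hodd
    exact hodd ▸ ih

/-- Sperner's lemma: let `T` be a triangulation of the geometric `n`-simplex `δ` with
vertices `v 0, …, v n` (a subdivision of the complex `Δ` consisting of `δ` and all its
faces), and let `φ` be a Sperner coloring of `T`: a map from the vertices of `T` to
`{0, …, n}` with `φ w ≠ i` whenever a vertex `w` of `T` lies in the face of `δ`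
opposite to `v i`.  Then the number of `n`-simplices of `T` whose vertex set is mapped
by `φ` onto all of `{0, …, n}` is odd. -/
theorem sperner_lemma (d n : ℕ)
    (v : Fin (n + 1) → EuclideanSpace ℝ (Fin d)) (hv : AffineIndependent ℝ v)
    (T : GeomComplex (EuclideanSpace ℝ (Fin d)))
    (hT : IsSubdivisionOfFaces T
      ((Finset.univ.image v).powerset.filter fun t => t.Nonempty))
    (φ : EuclideanSpace ℝ (Fin d) → Fin (n + 1))
    (hφ : ∀ w ∈ T.faces.biUnion id, ∀ i : Fin (n + 1),
      w ∈ convexHull ℝ (v '' {i}ᶜ) → φ w ≠ i) :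
    Odd (T.faces.filter fun σ =>
      σ.card = n + 1 ∧ σ.image φ = Finset.univ).card := by
  have himage : ∀ S : Finset (Fin (n + 1)),
      ((S.image v : Finset _) : Set (EuclideanSpace ℝ (Fin d))) = v '' S := fun S =>
    Finset.coe_image
  have hcov : ∀ S : Finset (Fin (n + 1)), S.Nonempty → ∀ x ∈ convexHull ℝ (v '' (S : Set _)),
      ∃ ρ ∈ T.faces, convexHull ℝ (ρ : Set _) ⊆ convexHull ℝ (v '' (S : Set _)) ∧
        x ∈ convexHull ℝ (ρ : Set _) := by
    intro S hS x hx
    have h := hT.2 (S.image v) (Finset.mem_filter.2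
      ⟨Finset.mem_powerset.2 (Finset.image_subset_image (Finset.subset_univ S)), hS.image v⟩)
    rw [himage] at h
    rw [h] at hx
    obtain ⟨ρ, hρ, hxρ⟩ := Set.mem_iUnion₂.1 hx
    obtain ⟨hρT, hρS⟩ := Finset.mem_filter.1 hρ
    obtain ⟨σ, hσ, rfl⟩ : ∃ σ ∈ T.faces, (σ : Set (EuclideanSpace ℝ (Fin d))) = ρ := by
      simpa [eq_comm] using hρT
    exact ⟨σ, hσ, hρS, hxρ⟩
  have hmem : ∀ σ ∈ T.faces, ∀ w ∈ σ, ∀ S : Finset (Fin (n + 1)),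
      w ∈ convexHull ℝ (v '' (S : Set _)) → φ w ∈ S := by
    intro σ hσ w hw S hwS
    by_contra hcon
    refine hφ w (Finset.mem_biUnion.2 ⟨σ, hσ, hw⟩) (φ w)
      (convexHull_mono (Set.image_mono fun i hi => ?_) hwS) rfl
    rintro rfl
    exact hcon hi
  have hodd := T.odd_card_rainbow hv hcov φ hmem Finset.univ_nonempty
  convert hodd using 2
  ext σ
  simp only [Finset.mem_filter, Finset.card_univ, Fintype.card_fin]
  refine and_congr_right fun hσ => ?_
  have hsub : convexHull ℝ (σ : Set (EuclideanSpace ℝ (Fin d))) ⊆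
      convexHull ℝ (v '' ((Finset.univ : Finset (Fin (n + 1))) : Set _)) := by
    obtain ⟨ρ, hρ, hσρ⟩ := hT.1 σ hσ
    refine hσρ.trans (convexHull_mono ?_)
    rw [← himage]
    exact Finset.coe_subset.2 (Finset.mem_powerset.1 (Finset.mem_filter.1 hρ).1)
  constructor
  · rintro ⟨h1, h2⟩
    exact ⟨hsub, h1, by convert h2⟩
  · rintro ⟨-, h1, h2⟩
    exact ⟨h1, by convert h2⟩
end
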